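/- Suppose α ≥ 1. There is a constant A_α > 0 depending on α but not on n such that for every integer n ≥ 2 and every real x₀, |Σ_{λ partition of n with W_α(λ) ≤ x₀} π_α(λ) − Φ(x₀)| ≤ A_α · n^{−1/4}. -/

import Mathlib

open Finset

namespace JackTest

def colLen {n : ℕ} (lam : n.Partition) (j : ℕ) : ℕ :=
  (lam.parts.filter (fun p => j < p)).card

def rowLen {n : ℕ} (lam : n.Partition) (i : ℕ) : ℕ :=
  ((Finset.range n).filter (fun j => i < colLen lam j)).card

def cells {n : ℕ} (lam : n.Partition) : Finset (ℕ × ℕ) :=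
  (Finset.range n ×ˢ Finset.range n).filter (fun s => s.2 < rowLen lam s.1)

def arm {n : ℕ} (lam : n.Partition) (s : ℕ × ℕ) : ℕ := rowLen lam s.1 - (s.2 + 1)

def leg {n : ℕ} (lam : n.Partition) (s : ℕ × ℕ) : ℕ := colLen lam s.2 - (s.1 + 1)

noncomputable def cLow (α : ℝ) {n : ℕ} (lam : n.Partition) : ℝ :=
  ∏ s ∈ cells lam, (α * arm lam s + leg lam s + 1)

noncomputable def cUp (α : ℝ) {n : ℕ} (lam : n.Partition) : ℝ :=
  ∏ s ∈ cells lam, (α * arm lam s + leg lam s + α)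

noncomputable def jackP (α : ℝ) {n : ℕ} (lam : n.Partition) : ℝ :=
  α ^ n * (n.factorial) / (cLow α lam * cUp α lam)

def nStat {n : ℕ} (lam : n.Partition) : ℕ := ∑ i ∈ Finset.range n, i * rowLen lam i

def nStatConj {n : ℕ} (lam : n.Partition) : ℕ := ∑ j ∈ Finset.range n, j * colLen lam j

noncomputable def W (α : ℝ) {n : ℕ} (lam : n.Partition) : ℝ :=
  (α * nStatConj lam - nStat lam) / Real.sqrt (α * n.choose 2)

noncomputable def Phi (x : ℝ) : ℝ :=
  (Real.sqrt (2 * Real.pi))⁻¹ * ∫ t in Set.Iic x, Real.exp (-t ^ 2 / 2)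

section Gaussian

/-- The standard normal density. -/
noncomputable def gaussDensity (x : ℝ) : ℝ :=
  (Real.sqrt (2 * Real.pi))⁻¹ * Real.exp (-x ^ 2 / 2)

lemma integrable_exp_neg_sq_half : MeasureTheory.Integrable fun t : ℝ => Real.exp (-t ^ 2 / 2) := by
  convert integrable_exp_neg_mul_sq (b := 1 / 2) (by norm_num) using 3
  ring

lemma integral_exp_neg_sq_half : ∫ t : ℝ, Real.exp (-t ^ 2 / 2) = Real.sqrt (2 * Real.pi) := by
  have h := integral_gaussian (1 / 2)
  rw [show Real.pi / (1 / 2) = 2 * Real.pi by ring] at h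
  rw [← h]
  congr 1
  ext t
  ring_nf

lemma hasDerivAt_Phi (x : ℝ) : HasDerivAt Phi (gaussDensity x) x := by
  have hcont : Continuous fun t : ℝ => Real.exp (-t ^ 2 / 2) := by fun_prop
  have h : Phi = fun x => (Real.sqrt (2 * Real.pi))⁻¹ *
      ((∫ t in Set.Iic (0 : ℝ), Real.exp (-t ^ 2 / 2)) +
        ∫ t in (0 : ℝ)..x, Real.exp (-t ^ 2 / 2)) := by
    ext x
    rw [Phi, ← intervalIntegral.integral_Iic_sub_Iic
      integrable_exp_neg_sq_half.integrableOn integrable_exp_neg_sq_half.integrableOn]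
    ring
  rw [h]
  exact ((intervalIntegral.integral_hasDerivAt_right (hcont.intervalIntegrable _ _)
    (hcont.stronglyMeasurableAtFilter _ _) hcont.continuousAt).const_add _).const_mul _

lemma gaussDensity_nonneg (x : ℝ) : 0 ≤ gaussDensity x := by
  unfold gaussDensity; positivity

lemma one_le_sqrt_two_pi : 1 ≤ Real.sqrt (2 * Real.pi) := by
  rw [Real.one_le_sqrt]
  linarith [Real.pi_gt_three]

/-- Gaussian decay beats any monomial of degree at most four. -/
lemma gaussDensity_mul_le (x : ℝ) : gaussDensity x * (1 + x ^ 2 / 2 + x ^ 4 / 8) ≤ 1 := by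
  have h1 : 1 + x ^ 2 / 2 + x ^ 4 / 8 ≤ Real.exp (x ^ 2 / 2) := by
    have := Real.quadratic_le_exp_of_nonneg (x := x ^ 2 / 2) (by positivity)
    calc _ = 1 + x ^ 2 / 2 + (x ^ 2 / 2) ^ 2 / 2 := by ring
      _ ≤ _ := this
  have h2 : Real.exp (-x ^ 2 / 2) * (1 + x ^ 2 / 2 + x ^ 4 / 8) ≤ 1 := by
    calc _ ≤ Real.exp (-x ^ 2 / 2) * Real.exp (x ^ 2 / 2) := by gcongr
      _ = 1 := by rw [← Real.exp_add]; simp [neg_div]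
  have h3 : (Real.sqrt (2 * Real.pi))⁻¹ ≤ 1 := inv_le_one_of_one_le₀ one_le_sqrt_two_pi
  have h4 : 0 ≤ (Real.sqrt (2 * Real.pi))⁻¹ := by positivity
  unfold gaussDensity
  rw [mul_assoc]
  exact mul_le_one₀ h3 (by positivity) h2

lemma hasDerivAt_gaussDensity (x : ℝ) : HasDerivAt gaussDensity (-x * gaussDensity x) x := by
  have h : HasDerivAt (fun x : ℝ => -x ^ 2 / 2) (-x) x := by
    have := ((hasDerivAt_pow 2 x).neg).div_const 2
    refine this.congr_deriv ?_
    push_cast; ring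
  refine ((h.exp).const_mul ((Real.sqrt (2 * Real.pi))⁻¹)).congr_deriv ?_
  unfold gaussDensity; ring

lemma hasDerivAt_mul_gaussDensity (x : ℝ) :
    HasDerivAt (fun y => y * gaussDensity y) ((1 - x ^ 2) * gaussDensity x) x := by
  refine ((hasDerivAt_id x).mul (hasDerivAt_gaussDensity x)).congr_deriv ?_
  simp; ring

lemma gaussDensity_le_one (x : ℝ) : gaussDensity x ≤ 1 := by
  have := gaussDensity_mul_le x
  have := gaussDensity_nonneg x
  nlinarith [mul_nonneg this (sq_nonneg x), mul_nonneg this (sq_nonneg (x ^ 2))]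

lemma abs_mul_gaussDensity_le (x : ℝ) : |x * gaussDensity x| ≤ 1 := by
  have h1 := gaussDensity_mul_le x
  have h0 := gaussDensity_nonneg x
  rw [abs_le]
  constructor <;> nlinarith [mul_nonneg h0 (sq_nonneg (x + 1)), mul_nonneg h0 (sq_nonneg (x - 1)),
    mul_nonneg h0 (sq_nonneg (x ^ 2))]

lemma abs_one_sub_sq_mul_gaussDensity_le (x : ℝ) : |(1 - x ^ 2) * gaussDensity x| ≤ 2 := by
  have h1 := gaussDensity_mul_le x
  have h0 := gaussDensity_nonneg x
  rw [abs_le]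
  constructor <;> nlinarith [mul_nonneg h0 (sq_nonneg x), mul_nonneg h0 (sq_nonneg (x ^ 2))]

lemma abs_mul_one_sub_sq_mul_gaussDensity_le (x : ℝ) :
    |x * ((1 - x ^ 2) * gaussDensity x)| ≤ 8 := by
  have h1 := gaussDensity_mul_le x
  have h0 := gaussDensity_nonneg x
  rw [abs_le]
  constructor <;> nlinarith [mul_nonneg h0 (sq_nonneg x), mul_nonneg h0 (sq_nonneg (x ^ 2)),
    mul_nonneg h0 (sq_nonneg (x ^ 2 - x)), mul_nonneg h0 (sq_nonneg (x ^ 2 + x)),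
    mul_nonneg h0 (sq_nonneg (x - 1)), mul_nonneg h0 (sq_nonneg (x + 1))]

/-- A third-order Taylor bound on the real line. -/
lemma abs_taylor_two_le {f f' f'' f''' : ℝ → ℝ} {C : ℝ} (h1 : ∀ x, HasDerivAt f (f' x) x)
    (h2 : ∀ x, HasDerivAt f' (f'' x) x) (h3 : ∀ x, HasDerivAt f'' (f''' x) x)
    (hC : ∀ x, |f''' x| ≤ C) (y h : ℝ) :
    |f (y + h) - f y - f' y * h - f'' y * h ^ 2 / 2| ≤ C * |h| ^ 3 := by
  have hC0 : 0 ≤ C := (abs_nonneg _).trans (hC 0)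
  have abs_le_of_mem : ∀ {s t : ℝ}, t ∈ Set.uIcc 0 s → |t| ≤ |s| := fun {s t} ht => by
    simpa using Set.abs_sub_left_of_mem_uIcc ht
  have hA : ∀ s, |f'' (y + s) - f'' y| ≤ C * |s| := fun s => by
    have := Convex.norm_image_sub_le_of_norm_hasDerivWithin_le (f := f'') (f' := f''') (C := C)
      (s := Set.univ) (x := y) (y := y + s) (fun x _ => (h3 x).hasDerivWithinAt)
      (fun x _ => hC x) convex_univ trivial trivial
    simpa using this
  have hB : ∀ s, |f' (y + s) - f' y - f'' y * s| ≤ C * |s| ^ 2 := fun s => by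
    have := Convex.norm_image_sub_le_of_norm_hasDerivWithin_le
      (f := fun t => f' (y + t) - f' y - f'' y * t) (f' := fun t => f'' (y + t) - f'' y)
      (C := C * |s|) (s := Set.uIcc 0 s) (x := 0) (y := s)
      (fun t _ => by
        have := (((h2 (y + t)).comp_const_add y t).sub_const (f' y)).sub
          ((hasDerivAt_id t).const_mul (f'' y))
        rw [mul_one] at this
        exact this.hasDerivWithinAt)
      (fun t ht => (hA t).trans (by have := abs_le_of_mem ht; gcongr))
      (convex_uIcc _ _) Set.left_mem_uIcc Set.right_mem_uIcc
    simp only [Real.norm_eq_abs] at this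
    refine le_of_eq_of_le ?_ (this.trans_eq ?_)
    · simp
    · rw [sub_zero]; ring
  have := Convex.norm_image_sub_le_of_norm_hasDerivWithin_le
      (f := fun t => f (y + t) - f y - f' y * t - f'' y * t ^ 2 / 2)
      (f' := fun t => f' (y + t) - f' y - f'' y * t)
      (C := C * |h| ^ 2) (s := Set.uIcc 0 h) (x := 0) (y := h)
      (fun t _ => by
        have := ((((h1 (y + t)).comp_const_add y t).sub_const (f y)).sub
          ((hasDerivAt_id t).const_mul (f' y))).sub
          (((hasDerivAt_pow 2 t).const_mul (f'' y)).div_const 2)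
        refine HasDerivAt.hasDerivWithinAt ?_
        refine this.congr_deriv ?_
        simp; ring)
      (fun t ht => (hB t).trans (by have := abs_le_of_mem ht; gcongr))
      (convex_uIcc _ _) Set.left_mem_uIcc Set.right_mem_uIcc
  simp only [Real.norm_eq_abs] at this
  refine le_of_eq_of_le ?_ (this.trans_eq ?_)
  · simp
  · rw [sub_zero]; ring

lemma abs_Phi_taylor_le (y h : ℝ) :
    |Phi (y + h) - Phi y - gaussDensity y * h + y * gaussDensity y * h ^ 2 / 2| ≤ 2 * |h| ^ 3 := by
  have := abs_taylor_two_le (f'' := fun x => -x * gaussDensity x)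
    (f''' := fun x => -((1 - x ^ 2) * gaussDensity x))
    hasDerivAt_Phi hasDerivAt_gaussDensity
    (fun x => by simpa [neg_mul] using (hasDerivAt_mul_gaussDensity x).fun_neg)
    (fun x => by rw [abs_neg]; exact abs_one_sub_sq_mul_gaussDensity_le x) y h
  convert this using 2
  ring

lemma hasDerivAt_div_sqrt (z : ℝ) {v : ℝ} (hv : 0 < v) :
    HasDerivAt (fun w => z / Real.sqrt w) (-(z / Real.sqrt v) / (2 * v)) v := by
  have hs : 0 < Real.sqrt v := Real.sqrt_pos.2 hv
  have := ((Real.hasDerivAt_sqrt hv.ne').inv hs.ne').const_mul z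
  refine this.congr_deriv ?_
  rw [Real.sq_sqrt hv.le]
  field_simp

lemma hasDerivAt_Phi_div_sqrt (z : ℝ) {v : ℝ} (hv : 0 < v) :
    HasDerivAt (fun w => Phi (z / Real.sqrt w))
      (-(z / Real.sqrt v * gaussDensity (z / Real.sqrt v)) / (2 * v)) v := by
  refine ((hasDerivAt_Phi (z / Real.sqrt v)).comp v (hasDerivAt_div_sqrt z hv)).congr_deriv ?_
  ring

lemma abs_Phi_div_sqrt_add_sub_le (z : ℝ) {v d : ℝ} (hv : 0 < v) (hd : 0 ≤ d) :
    |Phi (z / Real.sqrt (v + d)) - Phi (z / Real.sqrt v)| ≤ d / v := by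
  have := Convex.norm_image_sub_le_of_norm_hasDerivWithin_le
      (f := fun w => Phi (z / Real.sqrt w)) (C := 1 / v) (s := Set.Ici v) (x := v) (y := v + d)
      (fun w hw => (hasDerivAt_Phi_div_sqrt z (hv.trans_le hw)).hasDerivWithinAt)
      (fun w hw => by
        have hw' : v ≤ w := hw
        have hw0 : 0 < w := hv.trans_le hw
        rw [Real.norm_eq_abs, abs_div, abs_neg, abs_of_pos (show (0 : ℝ) < 2 * w by positivity)]
        exact div_le_div₀ zero_le_one (abs_mul_gaussDensity_le _) hv (by linarith))
      (convex_Ici v) (by simp) (by simpa)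
  simp only [Real.norm_eq_abs, add_sub_cancel_left, abs_of_nonneg hd] at this
  calc _ ≤ _ := this
    _ = _ := by ring

lemma abs_Phi_div_sqrt_taylor_le (z : ℝ) {v d : ℝ} (hv : 0 < v) (hd : 0 ≤ d) :
    |Phi (z / Real.sqrt (v + d)) - Phi (z / Real.sqrt v)
      + z / Real.sqrt v * gaussDensity (z / Real.sqrt v) / (2 * v) * d| ≤ 3 * d ^ 2 / v ^ 2 := by
  set y : ℝ → ℝ := fun w => z / Real.sqrt w with hy
  have hder : ∀ w, v ≤ w → HasDerivAt (fun w => -(y w * gaussDensity (y w)) / (2 * w))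
      ((y w * gaussDensity (y w) / 2 + y w * ((1 - y w ^ 2) * gaussDensity (y w)) / 4) / w ^ 2)
      w := fun w hw => by
    have hw0 : 0 < w := hv.trans_le hw
    have h1 := (hasDerivAt_mul_gaussDensity (y w)).comp w (hasDerivAt_div_sqrt z hw0)
    have h2 := h1.neg.div ((hasDerivAt_id w).const_mul 2) (by simpa using hw0.ne')
    refine h2.congr_deriv ?_
    simp only [Function.comp, Pi.neg_apply, id, hy]
    field_simp
    ring
  have hA : ∀ w ∈ Set.Icc v (v + d), |-(y w * gaussDensity (y w)) / (2 * w)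
      + y v * gaussDensity (y v) / (2 * v)| ≤ 3 / v ^ 2 * d := fun w hw => by
    have := Convex.norm_image_sub_le_of_norm_hasDerivWithin_le
      (f := fun w => -(y w * gaussDensity (y w)) / (2 * w)) (C := 3 / v ^ 2) (s := Set.Ici v)
      (x := v) (y := w)
      (fun w hw => (hder w hw).hasDerivWithinAt)
      (fun w hw => by
        have hw' : v ≤ w := hw
        rw [Real.norm_eq_abs, abs_div, abs_of_nonneg (sq_nonneg w)]
        refine div_le_div₀ (by norm_num) ?_ (by positivity) (by gcongr)
        have h1 := abs_le.1 (abs_mul_gaussDensity_le (y w))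
        have h2 := abs_le.1 (abs_mul_one_sub_sq_mul_gaussDensity_le (y w))
        rw [abs_le]; constructor <;> linarith [h1.1, h1.2, h2.1, h2.2])
      (convex_Ici v) (by simp) hw.1
    simp only [Real.norm_eq_abs] at this
    rw [abs_of_nonneg (sub_nonneg.2 hw.1)] at this
    calc _ = |-(y w * gaussDensity (y w)) / (2 * w) - -(y v * gaussDensity (y v)) / (2 * v)| := by
          congr 1; ring
      _ ≤ _ := this
      _ ≤ _ := by gcongr; linarith [hw.2]
  have := Convex.norm_image_sub_le_of_norm_hasDerivWithin_le
      (f := fun w => Phi (y w) + y v * gaussDensity (y v) / (2 * v) * (w - v))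
      (C := 3 / v ^ 2 * d) (s := Set.Icc v (v + d)) (x := v) (y := v + d)
      (fun w hw => by
        have := (hasDerivAt_Phi_div_sqrt z (hv.trans_le hw.1)).add
          (((hasDerivAt_id w).sub_const v).const_mul (y v * gaussDensity (y v) / (2 * v)))
        rw [mul_one] at this
        exact this.hasDerivWithinAt)
      (fun w hw => hA w hw) (convex_Icc _ _) (by simpa) (by simpa)
  simp only [Real.norm_eq_abs, add_sub_cancel_left, abs_of_nonneg hd, sub_self, mul_zero,
    add_zero] at this
  calc _ = _ := by congr 1; ring
    _ ≤ _ := this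
    _ = _ := by ring

/-- One step of the Lindeberg replacement: a centred finitely supported variable of variance `d`
may be exchanged for a Gaussian one under Gaussian smoothing of variance `v`. -/
lemma abs_sum_Phi_sub_le {ι : Type*} (s : Finset ι) (p X : ι → ℝ) (hp : ∀ i ∈ s, 0 ≤ p i)
    (h0 : ∑ i ∈ s, p i = 1) (h1 : ∑ i ∈ s, p i * X i = 0) {d : ℝ}
    (h2 : ∑ i ∈ s, p i * X i ^ 2 = d) (z : ℝ) {v : ℝ} (hv : 0 < v) :
    |∑ i ∈ s, p i * Phi ((z - X i) / Real.sqrt v) - Phi (z / Real.sqrt (v + d))| ≤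
      2 * (∑ i ∈ s, p i * |X i| ^ 3) / Real.sqrt v ^ 3 + 3 * d ^ 2 / v ^ 2 := by
  have hd : 0 ≤ d := h2 ▸ Finset.sum_nonneg fun i hi => mul_nonneg (hp i hi) (sq_nonneg _)
  have hs : 0 < Real.sqrt v := Real.sqrt_pos.2 hv
  have hsq : Real.sqrt v ^ 2 = v := Real.sq_sqrt hv.le
  set y := z / Real.sqrt v with hy
  have hT := abs_Phi_div_sqrt_taylor_le z hv hd
  rw [← hy] at hT
  have hS : |∑ i ∈ s, p i * (Phi (y + -(X i / Real.sqrt v)) - Phi y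
      - gaussDensity y * -(X i / Real.sqrt v)
      + y * gaussDensity y * (-(X i / Real.sqrt v)) ^ 2 / 2)| ≤
      2 * (∑ i ∈ s, p i * |X i| ^ 3) / Real.sqrt v ^ 3 := by
    refine (Finset.abs_sum_le_sum_abs _ _).trans ?_
    rw [Finset.mul_sum, Finset.sum_div]
    refine Finset.sum_le_sum fun i hi => ?_
    rw [abs_mul, abs_of_nonneg (hp i hi)]
    calc _ ≤ p i * (2 * |-(X i / Real.sqrt v)| ^ 3) :=
          mul_le_mul_of_nonneg_left (abs_Phi_taylor_le _ _) (hp i hi)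
      _ = _ := by rw [abs_neg, abs_div, abs_of_pos hs]; ring
  have hE : ∑ i ∈ s, p i * (Phi (y + -(X i / Real.sqrt v)) - Phi y
      - gaussDensity y * -(X i / Real.sqrt v)
      + y * gaussDensity y * (-(X i / Real.sqrt v)) ^ 2 / 2) =
      ∑ i ∈ s, p i * Phi ((z - X i) / Real.sqrt v) - Phi y + y * gaussDensity y / (2 * v) * d := by
    have : ∀ i, p i * (Phi (y + -(X i / Real.sqrt v)) - Phi y
      - gaussDensity y * -(X i / Real.sqrt v)
      + y * gaussDensity y * (-(X i / Real.sqrt v)) ^ 2 / 2) =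
        p i * Phi ((z - X i) / Real.sqrt v) - p i * Phi y
        + (p i * X i) * (gaussDensity y / Real.sqrt v)
        + (p i * X i ^ 2) * (y * gaussDensity y / (2 * v)) := fun i => by
      rw [show y + -(X i / Real.sqrt v) = (z - X i) / Real.sqrt v by rw [hy]; ring]
      rw [neg_sq, div_pow, hsq]
      field_simp
      ring
    simp_rw [this, Finset.sum_add_distrib, Finset.sum_sub_distrib, ← Finset.sum_mul, h0, h1, h2]
    ring
  rw [hE] at hS
  rw [abs_le] at *
  constructor <;> linarith [hS.1, hS.2, hT.1, hT.2]

lemma Phi_mono : Monotone Phi :=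
  monotone_of_hasDerivAt_nonneg hasDerivAt_Phi gaussDensity_nonneg

lemma abs_Phi_sub_le (x y : ℝ) : |Phi y - Phi x| ≤ |y - x| := by
  have := Convex.norm_image_sub_le_of_norm_hasDerivWithin_le (f := Phi) (C := 1)
      (s := Set.univ) (x := x) (y := y) (fun x _ => (hasDerivAt_Phi x).hasDerivWithinAt)
      (fun x _ => by
        rw [Real.norm_eq_abs, abs_of_nonneg (gaussDensity_nonneg x)]
        exact gaussDensity_le_one x) convex_univ trivial trivial
  simpa using this

lemma Phi_nonneg (x : ℝ) : 0 ≤ Phi x := by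
  unfold Phi
  exact mul_nonneg (by positivity) (MeasureTheory.integral_nonneg fun _ => (Real.exp_pos _).le)

lemma Phi_add_Phi_neg (x : ℝ) : Phi x + Phi (-x) = 1 := by
  have h : ∫ t in Set.Iic (-x), Real.exp (-t ^ 2 / 2) =
      ∫ t in Set.Ioi x, Real.exp (-t ^ 2 / 2) := by
    rw [← integral_comp_neg_Ioi x fun t => Real.exp (-t ^ 2 / 2)]
    congr 1
    ext t
    ring_nf
  rw [Phi, Phi, h, ← mul_add, intervalIntegral.integral_Iic_add_Ioi
    integrable_exp_neg_sq_half.integrableOn integrable_exp_neg_sq_half.integrableOn,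
    integral_exp_neg_sq_half, inv_mul_cancel₀]
  linarith [one_le_sqrt_two_pi]

lemma Phi_neg_le {t : ℝ} (ht : 0 ≤ t) : Phi (-t) ≤ Real.exp (-t ^ 2 / 2) := by
  have h1 : ∫ s in Set.Iic (-t), Real.exp (-s ^ 2 / 2) =
      ∫ s in Set.Iic (0 : ℝ), Real.exp (-(s - t) ^ 2 / 2) := by
    have := MeasureTheory.integral_sub_right_eq_self
      (fun s => Set.indicator (Set.Iic (-t)) (fun s => Real.exp (-s ^ 2 / 2)) s)
      (μ := MeasureTheory.volume) t
    rw [MeasureTheory.integral_indicator measurableSet_Iic] at this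
    rw [← this, ← MeasureTheory.integral_indicator measurableSet_Iic]
    congr 1
    ext s
    by_cases hs : s ≤ 0 <;> simp [Set.indicator, hs]
  have h2 : ∫ s in Set.Iic (0 : ℝ), Real.exp (-(s - t) ^ 2 / 2) ≤
      ∫ s in Set.Iic (0 : ℝ), Real.exp (-t ^ 2 / 2) * Real.exp (-s ^ 2 / 2) := by
    refine MeasureTheory.setIntegral_mono_on
      (integrable_exp_neg_sq_half.comp_sub_right t).integrableOn
      (integrable_exp_neg_sq_half.const_mul _).integrableOn measurableSet_Iic fun s hs => ?_
    have hs' : s ≤ 0 := hs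
    rw [← Real.exp_add]
    gcongr
    nlinarith [mul_nonneg ht (neg_nonneg.2 hs')]
  have h3 : ∫ s in Set.Iic (0 : ℝ), Real.exp (-s ^ 2 / 2) ≤ Real.sqrt (2 * Real.pi) := by
    rw [← integral_exp_neg_sq_half]
    exact MeasureTheory.setIntegral_le_integral integrable_exp_neg_sq_half
      (Filter.Eventually.of_forall fun _ => (Real.exp_pos _).le)
  have hp : 0 < Real.sqrt (2 * Real.pi) := by linarith [one_le_sqrt_two_pi]
  rw [MeasureTheory.integral_const_mul] at h2
  rw [Phi, inv_mul_le_iff₀ hp, h1]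
  refine h2.trans ?_
  rw [mul_comm]
  gcongr

lemma gaussDensity_ge {t x : ℝ} (h : x ^ 2 ≤ t ^ 2 + 1) :
    Real.exp (-t ^ 2 / 2) ≤ 6 * gaussDensity x := by
  have hs : Real.sqrt (2 * Real.pi) ≤ 3 := by
    rw [Real.sqrt_le_left (by norm_num)]
    nlinarith [Real.pi_lt_d2]
  have hs0 : 0 < Real.sqrt (2 * Real.pi) := by linarith [one_le_sqrt_two_pi]
  have he : Real.exp (1 / 2) ≤ 2 := by
    rw [← Real.le_log_iff_exp_le (by norm_num)]
    linarith [Real.log_two_gt_d9]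
  have h1 : Real.exp (-t ^ 2 / 2) ≤ Real.exp (1 / 2) * Real.exp (-x ^ 2 / 2) := by
    rw [← Real.exp_add]
    gcongr
    linarith
  have h2 : Real.exp (-x ^ 2 / 2) = Real.sqrt (2 * Real.pi) * gaussDensity x := by
    unfold gaussDensity; field_simp
  have hg := gaussDensity_nonneg x
  calc _ ≤ _ := h1
    _ ≤ 2 * (3 * gaussDensity x) := by rw [h2]; gcongr
    _ = _ := by ring

lemma exp_neg_sq_half_le_Phi_sub (t : ℝ) :
    Real.exp (-t ^ 2 / 2) ≤ 6 * (Phi (t + 1) - Phi (t - 1)) := by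
  have mvt : ∀ a : ℝ, ∃ c ∈ Set.Ioo a (a + 1), gaussDensity c = Phi (a + 1) - Phi a := fun a => by
    obtain ⟨c, hc, h⟩ := exists_hasDerivAt_eq_slope Phi gaussDensity (lt_add_one a)
      (fun x _ => (hasDerivAt_Phi x).continuousAt.continuousWithinAt) fun x _ => hasDerivAt_Phi x
    exact ⟨c, hc, by simpa using h⟩
  rcases le_total 0 t with ht | ht
  · obtain ⟨c, ⟨hc1, hc2⟩, hc⟩ := mvt (t - 1)
    rw [sub_add_cancel] at hc hc2
    have h1 := gaussDensity_ge (t := t) (x := c) (by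
      rcases le_total 0 c with h | h <;> nlinarith)
    have h2 : Phi t ≤ Phi (t + 1) := Phi_mono (by linarith)
    linarith
  · obtain ⟨c, ⟨hc1, hc2⟩, hc⟩ := mvt t
    have h1 := gaussDensity_ge (t := t) (x := c) (by
      rcases le_total 0 c with h | h <;> nlinarith)
    have h2 : Phi (t - 1) ≤ Phi t := Phi_mono (by linarith)
    linarith

/-- The error of smoothing an indicator is dominated by a window of the smoothing kernel. -/
lemma abs_indicator_sub_Phi_le (t : ℝ) :
    |(if 0 ≤ t then (1 : ℝ) else 0) - Phi t| ≤ 6 * (Phi (t + 1) - Phi (t - 1)) := by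
  refine le_trans ?_ (exp_neg_sq_half_le_Phi_sub t)
  split_ifs with ht
  · rw [← Phi_add_Phi_neg t, add_sub_cancel_left, abs_of_nonneg (Phi_nonneg _)]
    exact Phi_neg_le ht
  · rw [zero_sub, abs_neg, abs_of_nonneg (Phi_nonneg _)]
    simpa using Phi_neg_le (t := -t) (by linarith)

end Gaussian

section Residues

variable {ι : Type*} [DecidableEq ι]

/-- The residue at `a i` of `z ↦ ∏ k ∈ s, (1 + t / (z - a k))`, divided by `t`. -/
noncomputable def residueWeight (t : ℝ) (s : Finset ι) (a : ι → ℝ) (i : ι) : ℝ :=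
  ∏ k ∈ s.erase i, (1 + t / (a i - a k))

lemma residueWeight_insert_of_mem (t : ℝ) {s : Finset ι} (a : ι → ℝ) {b i : ι} (hb : b ∉ s)
    (hi : i ∈ s) :
    residueWeight t (insert b s) a i = residueWeight t s a i * (1 + t / (a i - a b)) := by
  have hne : b ≠ i := fun h => hb (h ▸ hi)
  rw [residueWeight, erase_insert_of_ne hne, prod_insert fun h => hb (mem_of_mem_erase h),
    mul_comm, residueWeight]

lemma residueWeight_insert_self (t : ℝ) {s : Finset ι} (a : ι → ℝ) {b : ι} (hb : b ∉ s) :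
    residueWeight t (insert b s) a b = ∏ k ∈ s, (1 + t / (a b - a k)) := by
  rw [residueWeight, erase_insert hb]

/-- Partial fraction expansion of `∏ k ∈ s, (1 + t / (z - a k))`. -/
lemma prod_one_add_div (t : ℝ) (s : Finset ι) (a : ι → ℝ) (ha : Set.InjOn a s) (z : ℝ)
    (hz : ∀ i ∈ s, z ≠ a i) :
    ∏ k ∈ s, (1 + t / (z - a k)) = 1 + t * ∑ i ∈ s, residueWeight t s a i / (z - a i) := by
  induction s using Finset.induction_on generalizing z with
  | empty => simp
  | insert b s hb ih =>
    have ha' : Set.InjOn a s := ha.mono (by simp)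
    have hbi : ∀ i ∈ s, a b ≠ a i := fun i hi h =>
      hb (ha (mem_insert_self b s) (mem_insert_of_mem hi) h ▸ hi)
    have hzb : z - a b ≠ 0 := sub_ne_zero.2 (hz b (mem_insert_self b s))
    rw [prod_insert hb, ih ha' z fun i hi => hz i (mem_insert_of_mem hi), sum_insert hb,
      residueWeight_insert_self t a hb, ih ha' (a b) hbi]
    have hsum : ∑ i ∈ s, residueWeight t (insert b s) a i / (z - a i) =
        ∑ i ∈ s, residueWeight t s a i / (z - a i) + t / (z - a b) *
          (∑ i ∈ s, residueWeight t s a i / (z - a i) -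
            ∑ i ∈ s, residueWeight t s a i / (a b - a i)) := by
      rw [← sum_sub_distrib, mul_sum, ← sum_add_distrib]
      refine sum_congr rfl fun i hi => ?_
      have h1 : z - a i ≠ 0 := sub_ne_zero.2 (hz i (mem_insert_of_mem hi))
      have h2 : a b - a i ≠ 0 := sub_ne_zero.2 (hbi i hi)
      have h3 : a i - a b ≠ 0 := sub_ne_zero.2 (hbi i hi).symm
      rw [residueWeight_insert_of_mem t a hb hi]
      rw [show t / (a i - a b) = -(t / (a b - a i)) by rw [← neg_sub (a b), div_neg]]
      field_simp
      ring
    rw [hsum]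
    field_simp
    ring

lemma sum_residueWeight (t : ℝ) (s : Finset ι) (a : ι → ℝ) (ha : Set.InjOn a s) :
    ∑ i ∈ s, residueWeight t s a i = #s := by
  induction s using Finset.induction_on with
  | empty => simp
  | insert b s hb ih =>
    have ha' : Set.InjOn a s := ha.mono (by simp)
    have hbi : ∀ i ∈ s, a b ≠ a i := fun i hi h =>
      hb (ha (mem_insert_self b s) (mem_insert_of_mem hi) h ▸ hi)
    rw [sum_insert hb, residueWeight_insert_self t a hb, prod_one_add_div t s a ha' _ hbi,
      card_insert_of_notMem hb]
    have hsum : ∑ i ∈ s, residueWeight t (insert b s) a i =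
        ∑ i ∈ s, residueWeight t s a i - t * ∑ i ∈ s, residueWeight t s a i / (a b - a i) := by
      rw [mul_sum, ← sum_sub_distrib]
      refine sum_congr rfl fun i hi => ?_
      rw [residueWeight_insert_of_mem t a hb hi, ← neg_sub (a b), div_neg]
      ring
    rw [hsum, ih ha']
    push_cast
    ring

lemma sum_mul_residueWeight (t : ℝ) (s : Finset ι) (a : ι → ℝ) (ha : Set.InjOn a s) :
    ∑ i ∈ s, a i * residueWeight t s a i = ∑ i ∈ s, a i + t * ((#s : ℝ) * (#s - 1) / 2) := by
  induction s using Finset.induction_on with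
  | empty => simp
  | insert b s hb ih =>
    have ha' : Set.InjOn a s := ha.mono (by simp)
    have hbi : ∀ i ∈ s, a b ≠ a i := fun i hi h =>
      hb (ha (mem_insert_self b s) (mem_insert_of_mem hi) h ▸ hi)
    rw [sum_insert hb, residueWeight_insert_self t a hb, prod_one_add_div t s a ha' _ hbi,
      card_insert_of_notMem hb, sum_insert hb]
    have hsum : ∑ i ∈ s, a i * residueWeight t (insert b s) a i =
        ∑ i ∈ s, a i * residueWeight t s a i + t * ∑ i ∈ s, residueWeight t s a i
          - a b * (t * ∑ i ∈ s, residueWeight t s a i / (a b - a i)) := by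
      rw [mul_sum, mul_sum, mul_sum, ← sum_add_distrib, ← sum_sub_distrib]
      refine sum_congr rfl fun i hi => ?_
      have h2 : a b - a i ≠ 0 := sub_ne_zero.2 (hbi i hi)
      rw [residueWeight_insert_of_mem t a hb hi, ← neg_sub (a b), div_neg]
      field_simp
      ring
    rw [hsum, ih ha', sum_residueWeight t s a ha']
    push_cast
    ring

end Residues

section Rows

/-- The anisotropic content of the box just to the right of row `i`. -/
def edge (α : ℝ) (ρ : ℕ → ℕ) (i : ℕ) : ℝ := α * ρ i - i

lemma edge_strictAnti {α : ℝ} (hα : 0 < α) {ρ : ℕ → ℕ} (hρ : Antitone ρ) :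
    StrictAnti (edge α ρ) := fun i j hij => by
  have h1 : (ρ j : ℝ) ≤ ρ i := by exact_mod_cast hρ hij.le
  have h2 : (i : ℝ) < j := by exact_mod_cast hij
  unfold edge
  nlinarith [mul_le_mul_of_nonneg_left h1 hα.le]

lemma edge_injective {α : ℝ} (hα : 0 < α) {ρ : ℕ → ℕ} (hρ : Antitone ρ) :
    Function.Injective (edge α ρ) := (edge_strictAnti hα hρ).injective

/-- The probability that a box is added to row `r`, computed using rows below `M`. -/
noncomputable def upProb (α : ℝ) (M : ℕ) (ρ : ℕ → ℕ) (r : ℕ) : ℝ :=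
  residueWeight 1 (range M) (edge α ρ) r / (edge α ρ r + M)

/-- The weight with which a box is removed from row `r`, computed using rows below `M`. -/
noncomputable def downWeight (α : ℝ) (M : ℕ) (ρ : ℕ → ℕ) (r : ℕ) : ℝ :=
  residueWeight (-1) (range M) (edge α ρ) r * (edge α ρ r - 1 + M)

variable {α : ℝ} {M : ℕ} {ρ : ℕ → ℕ}

lemma edge_add_pos (hα : 0 < α) {r : ℕ} (hr : r < M) : 0 < edge α ρ r + M := by
  have h2 : (r : ℝ) < M := by exact_mod_cast hr
  have : 0 ≤ α * ρ r := by positivity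
  unfold edge
  linarith

lemma sum_edge (α : ℝ) (M : ℕ) (ρ : ℕ → ℕ) :
    ∑ i ∈ range M, edge α ρ i = α * (∑ i ∈ range M, ρ i : ℕ) - (M : ℝ) * (M - 1) / 2 := by
  have h : ∑ i ∈ range M, (i : ℝ) = (M : ℝ) * (M - 1) / 2 := by
    induction M with
    | zero => simp
    | succ m ih => rw [sum_range_succ, ih]; push_cast; ring
  simp only [edge, sum_sub_distrib, h, ← mul_sum, Nat.cast_sum]

lemma sum_upProb (hα : 0 < α) (hρ : Antitone ρ) (hM : 0 < M) (h0 : ρ (M - 1) = 0) :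
    ∑ r ∈ range M, upProb α M ρ r = 1 := by
  have h := prod_one_add_div 1 (range M) (edge α ρ) (edge_injective hα hρ).injOn (-(M : ℝ))
    fun i hi => by have := edge_add_pos (ρ := ρ) hα (mem_range.1 hi); linarith
  have hz : ∏ k ∈ range M, (1 + 1 / (-(M : ℝ) - edge α ρ k)) = 0 := by
    refine prod_eq_zero (mem_range.2 (Nat.sub_lt hM one_pos)) ?_
    rw [edge, h0, Nat.cast_sub (show 1 ≤ M from hM), Nat.cast_zero, mul_zero, Nat.cast_one]
    ring_nf
  have hs : ∑ i ∈ range M, residueWeight 1 (range M) (edge α ρ) i / (-(M : ℝ) - edge α ρ i) =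
      -∑ r ∈ range M, upProb α M ρ r := by
    rw [← sum_neg_distrib]
    refine sum_congr rfl fun i _ => ?_
    rw [upProb, ← div_neg]
    congr 1
    ring
  rw [hz, hs] at h
  linarith

lemma edge_add_mul_upProb (hα : 0 < α) {r : ℕ} (hr : r < M) :
    (edge α ρ r + M) * upProb α M ρ r = residueWeight 1 (range M) (edge α ρ) r :=
  mul_div_cancel₀ _ (edge_add_pos hα hr).ne'

lemma sum_upProb_mul_edge (hα : 0 < α) (hρ : Antitone ρ) (hM : 0 < M) (h0 : ρ (M - 1) = 0) :
    ∑ r ∈ range M, upProb α M ρ r * edge α ρ r = 0 := by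
  have h := sum_residueWeight 1 (range M) (edge α ρ) (edge_injective hα hρ).injOn
  rw [← sum_congr rfl fun r hr => edge_add_mul_upProb hα (mem_range.1 hr)] at h
  have h1 := sum_upProb hα hρ hM h0
  simp only [add_mul, sum_add_distrib, ← mul_sum, h1, card_range] at h
  simp only [mul_comm (upProb _ _ _ _)]
  linarith

lemma sum_upProb_mul_edge_sq (hα : 0 < α) (hρ : Antitone ρ) (hM : 0 < M) (h0 : ρ (M - 1) = 0) :
    ∑ r ∈ range M, upProb α M ρ r * edge α ρ r ^ 2 = α * (∑ i ∈ range M, ρ i : ℕ) := by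
  have h := sum_mul_residueWeight 1 (range M) (edge α ρ) (edge_injective hα hρ).injOn
  rw [sum_edge, ← sum_congr rfl fun r hr => congrArg (edge α ρ r * ·)
    (edge_add_mul_upProb hα (mem_range.1 hr))] at h
  have h1 := sum_upProb_mul_edge hα hρ hM h0
  have h2 : ∑ r ∈ range M, edge α ρ r * ((edge α ρ r + M) * upProb α M ρ r) =
      ∑ r ∈ range M, upProb α M ρ r * edge α ρ r ^ 2 +
        M * ∑ r ∈ range M, upProb α M ρ r * edge α ρ r := by
    rw [mul_sum, ← sum_add_distrib]
    exact sum_congr rfl fun r _ => by ring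
  rw [h2, h1, card_range] at h
  linarith

lemma sum_downWeight (hα : 0 < α) (hρ : Antitone ρ) :
    ∑ r ∈ range M, downWeight α M ρ r = α * (∑ i ∈ range M, ρ i : ℕ) := by
  have h0 := sum_residueWeight (-1) (range M) (edge α ρ) (edge_injective hα hρ).injOn
  have h1 := sum_mul_residueWeight (-1) (range M) (edge α ρ) (edge_injective hα hρ).injOn
  have h2 : ∑ r ∈ range M, downWeight α M ρ r =
      ∑ r ∈ range M, edge α ρ r * residueWeight (-1) (range M) (edge α ρ) r
        + (M - 1) * ∑ r ∈ range M, residueWeight (-1) (range M) (edge α ρ) r := by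
    rw [mul_sum, ← sum_add_distrib]
    exact sum_congr rfl fun r _ => by rw [downWeight]; ring
  rw [h2, h0, h1, sum_edge, card_range]
  ring

lemma upProb_nonneg (hα : 0 < α) (hρ : Antitone ρ) {r : ℕ} (hr : r < M) :
    0 ≤ upProb α M ρ r := by
  refine div_nonneg (prod_nonneg fun k hk => ?_) (edge_add_pos hα hr).le
  rcases lt_or_gt_of_ne (ne_of_mem_erase hk) with h | h
  · have h1 : edge α ρ r - edge α ρ k ≤ -1 := by
      have h1 : (ρ r : ℝ) ≤ ρ k := by exact_mod_cast hρ h.le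
      have h2 : (k : ℝ) + 1 ≤ r := by exact_mod_cast h
      unfold edge
      nlinarith [mul_le_mul_of_nonneg_left h1 hα.le]
    have h2 := one_div_le_one_div_of_le one_pos (le_neg.1 h1)
    rw [div_neg, div_one] at h2
    linarith
  · have := sub_pos.2 (edge_strictAnti hα hρ h)
    positivity

/-- A box cannot be added to a row that is as long as the previous one. -/
lemma upProb_eq_zero {r : ℕ} (hr : r + 1 < M) (h : ρ r = ρ (r + 1)) :
    upProb α M ρ (r + 1) = 0 := by
  refine div_eq_zero_iff.2 (Or.inl (prod_eq_zero (i := r) (by simp; omega) ?_))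
  simp [edge, h]

/-- A box cannot be removed from a row that is as long as the next one. -/
lemma downWeight_eq_zero {r : ℕ} (hr : r < M) (h : ρ r = ρ (r + 1)) (h0 : ρ (M - 1) = 0) :
    downWeight α M ρ r = 0 := by
  rcases Nat.lt_or_ge (r + 1) M with h1 | h1
  · refine mul_eq_zero.2 (Or.inl (prod_eq_zero (i := r + 1) (by simp; omega) ?_))
    simp [edge, h]
  · obtain rfl : r = M - 1 := by omega
    have : 1 ≤ M := by omega
    refine mul_eq_zero.2 (Or.inr ?_)
    rw [edge, h0, Nat.cast_sub this]
    norm_num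

/-- The row lengths after adding a box to row `r`. -/
def addAt (ρ : ℕ → ℕ) (r : ℕ) : ℕ → ℕ := Function.update ρ r (ρ r + 1)

lemma edge_addAt_self (r : ℕ) : edge α (addAt ρ r) r = edge α ρ r + α := by
  simp [edge, addAt]; ring

lemma edge_addAt_of_ne {r i : ℕ} (h : i ≠ r) : edge α (addAt ρ r) i = edge α ρ i := by
  simp [edge, addAt, h]

lemma sum_addAt {r : ℕ} (hr : r < M) : ∑ i ∈ range M, addAt ρ r i = ∑ i ∈ range M, ρ i + 1 := by
  rw [addAt, sum_update_of_mem (mem_range.2 hr), ← sum_erase_add _ _ (mem_range.2 hr),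
    sdiff_singleton_eq_erase]
  ring

/-- Adding a box intertwines the two transition measures. -/
lemma sum_upProb_addAt (hα : 0 < α) (hρ : Antitone ρ) {r : ℕ} (hr : r < M)
    (hadd : Antitone (addAt ρ r)) (g : ℝ → ℝ) :
    ∑ i ∈ range M, upProb α M (addAt ρ r) i * ((edge α (addAt ρ r) i - edge α ρ r - α) *
        (edge α (addAt ρ r) i - edge α ρ r + 1) * g (edge α (addAt ρ r) i)) =
      ∑ i ∈ range M, upProb α M ρ i * ((edge α ρ i - edge α ρ r) *
        (edge α ρ i - edge α ρ r + (1 - α)) * g (edge α ρ i)) := by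
  refine sum_congr rfl fun i hi => ?_
  by_cases hir : i = r
  · subst hir
    rw [edge_addAt_self]
    ring
  have h1 : edge α ρ i - edge α ρ r ≠ 0 :=
    sub_ne_zero.2 ((edge_injective hα hρ).ne hir)
  have h2 : edge α ρ i - edge α ρ r - α ≠ 0 := by
    have := (edge_injective hα hadd).ne hir
    rw [edge_addAt_of_ne hir, edge_addAt_self] at this
    rw [sub_sub]
    exact sub_ne_zero.2 this
  have hmem : r ∈ (range M).erase i := by simp [Ne.symm hir, hr]
  have hR : ∀ σ : ℕ → ℕ, upProb α M σ i = (1 + 1 / (edge α σ i - edge α σ r)) *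
      (∏ k ∈ ((range M).erase i).erase r, (1 + 1 / (edge α σ i - edge α σ k)))
        / (edge α σ i + M) := fun σ => by
    rw [upProb, residueWeight, ← mul_prod_erase _ _ hmem]
  have hP : ∏ k ∈ ((range M).erase i).erase r, (1 + 1 / (edge α ρ i - edge α (addAt ρ r) k)) =
      ∏ k ∈ ((range M).erase i).erase r, (1 + 1 / (edge α ρ i - edge α ρ k)) :=
    prod_congr rfl fun k hk => by rw [edge_addAt_of_ne (ne_of_mem_erase hk)]
  rw [hR, hR, edge_addAt_of_ne hir, edge_addAt_self, hP, ← sub_sub]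
  field_simp
  ring

/-- The fourth moment of the transition measure. -/
noncomputable def fourthMoment (α : ℝ) (M : ℕ) (ρ : ℕ → ℕ) : ℝ :=
  ∑ i ∈ range M, upProb α M ρ i * edge α ρ i ^ 4

lemma fourthMoment_addAt (hα : 0 < α) (hρ : Antitone ρ) {r : ℕ} (hr : r < M)
    (hadd : Antitone (addAt ρ r)) (h0 : ρ (M - 1) = 0) (h0' : addAt ρ r (M - 1) = 0) :
    fourthMoment α M (addAt ρ r) = fourthMoment α M ρ +
      α * (3 * edge α ρ r ^ 2 + 3 * (α - 1) * edge α ρ r + α ^ 2 - α + 1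
        + α * (∑ i ∈ range M, ρ i : ℕ)) := by
  have hM : 0 < M := by omega
  have e1 := sum_upProb_addAt hα hρ hr hadd id
  have e2 := sum_upProb_addAt hα hρ hr hadd (· ^ 2)
  have m1 := sum_upProb_mul_edge hα hρ hM h0
  have m2 := sum_upProb_mul_edge_sq hα hρ hM h0
  have n1 := sum_upProb_mul_edge hα hadd hM h0'
  have n2 := sum_upProb_mul_edge_sq hα hadd hM h0'
  rw [sum_addAt hr] at n2
  push_cast at m2 n2 ⊢
  set c := edge α ρ r
  have expand : ∀ (p x : ℕ → ℝ) (u v : ℝ),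
      (∑ i ∈ range M, p i * ((x i - c - u) * (x i - c + v) * id (x i)) =
        ∑ i ∈ range M, p i * x i ^ 3 + (v - u - 2 * c) * ∑ i ∈ range M, p i * x i ^ 2
          + (c + u) * (c - v) * ∑ i ∈ range M, p i * x i) ∧
      (∑ i ∈ range M, p i * ((x i - c - u) * (x i - c + v) * x i ^ 2) =
        ∑ i ∈ range M, p i * x i ^ 4 + (v - u - 2 * c) * ∑ i ∈ range M, p i * x i ^ 3
          + (c + u) * (c - v) * ∑ i ∈ range M, p i * x i ^ 2) := fun p x u v => by
    simp only [mul_sum, ← sum_add_distrib]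
    exact ⟨sum_congr rfl fun i _ => by simp only [id]; ring, sum_congr rfl fun i _ => by ring⟩
  have f1 := (expand (upProb α M ρ) (edge α ρ) 0 (1 - α)).1
  have f2 := (expand (upProb α M ρ) (edge α ρ) 0 (1 - α)).2
  have g1 := (expand (upProb α M (addAt ρ r)) (edge α (addAt ρ r)) α 1).1
  have g2 := (expand (upProb α M (addAt ρ r)) (edge α (addAt ρ r)) α 1).2
  simp only [sub_zero] at f1 f2
  rw [f1, g1, m1, m2, n1, n2] at e1
  rw [f2, g2, m2, n2] at e2
  unfold fourthMoment
  linear_combination e2 + (α - 1 + 2 * c) * e1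

end Rows

section Shapes

lemma lt_card_filter_range_iff {n : ℕ} {P : ℕ → Prop} [DecidablePred P]
    (hP : ∀ a b, a ≤ b → P b → P a) (hn : ∀ j, P j → j < n) (j : ℕ) :
    j < #{i ∈ range n | P i} ↔ P j := by
  constructor
  · intro h
    by_contra hj
    have hsub : {i ∈ range n | P i} ⊆ range j := fun i hi => by
      simp only [mem_filter, mem_range] at hi ⊢
      by_contra hij
      exact hj (hP _ _ (not_lt.1 hij) hi.2)
    simpa using h.trans_le (card_le_card hsub)
  · intro h
    have hsub : range (j + 1) ⊆ {i ∈ range n | P i} := fun i hi => by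
      simp only [mem_filter, mem_range] at hi ⊢
      exact ⟨(Nat.lt_succ_iff.1 hi).trans_lt (hn j h), hP _ _ (Nat.lt_succ_iff.1 hi) h⟩
    simpa using card_le_card hsub

variable {n : ℕ}

lemma colLen_antitone (lam : n.Partition) : Antitone (colLen lam) := fun _ _ hij =>
  Multiset.card_le_card (Multiset.monotone_filter_right _ fun _ h => hij.trans_lt h)

lemma colLen_eq_zero (lam : n.Partition) {j : ℕ} (hj : n ≤ j) : colLen lam j = 0 := by
  rw [colLen, Multiset.card_eq_zero, Multiset.filter_eq_nil]
  exact fun p hp => not_lt.2 ((Nat.Partition.le_of_mem_parts hp).trans hj)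

lemma lt_rowLen_iff (lam : n.Partition) (i j : ℕ) : j < rowLen lam i ↔ i < colLen lam j :=
  lt_card_filter_range_iff (fun _ _ hab h => h.trans_le (colLen_antitone lam hab))
    (fun j h => by
      by_contra hj
      rw [colLen_eq_zero lam (not_lt.1 hj)] at h
      exact Nat.not_lt_zero _ h) j

lemma rowLen_antitone (lam : n.Partition) : Antitone (rowLen lam) := fun i j hij => by
  refine le_of_forall_lt fun k hk => ?_
  rw [lt_rowLen_iff] at hk ⊢
  exact hij.trans_lt hk

lemma colLen_le (lam : n.Partition) (j : ℕ) : colLen lam j ≤ n := by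
  calc colLen lam j ≤ Multiset.card lam.parts := Multiset.card_le_card (Multiset.filter_le _ _)
    _ ≤ lam.parts.sum := by
        simpa using Multiset.card_nsmul_le_sum (s := lam.parts) (a := 1)
          fun p hp => lam.parts_pos hp
    _ = n := lam.parts_sum

lemma rowLen_eq_zero (lam : n.Partition) {i : ℕ} (hi : n ≤ i) : rowLen lam i = 0 := by
  by_contra h
  have := (lt_rowLen_iff lam i 0).1 (Nat.pos_of_ne_zero h)
  have := colLen_le lam 0
  omega

lemma rowLen_le (lam : n.Partition) (i : ℕ) : rowLen lam i ≤ n := by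
  simpa [rowLen] using card_filter_le (range n) fun j => i < colLen lam j

lemma sum_card_filter_lt (n : ℕ) (s : Multiset ℕ) (hs : ∀ p ∈ s, p ≤ n) :
    ∑ j ∈ range n, Multiset.card (s.filter (j < ·)) = s.sum := by
  induction s using Multiset.induction_on with
  | empty => simp
  | cons p s ih =>
    have hp : p ≤ n := hs p (Multiset.mem_cons_self p s)
    have h1 : ∀ j, Multiset.card ((p ::ₘ s).filter (j < ·)) =
        (if j < p then 1 else 0) + Multiset.card (s.filter (j < ·)) := fun j => by
      split_ifs with h <;> simp [h, add_comm]
    have h2 : #{j ∈ range n | j < p} = p := by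
      rw [show {j ∈ range n | j < p} = range p by ext; simp; omega, card_range]
    simp only [h1, sum_add_distrib, sum_boole, h2, Multiset.sum_cons,
      ih fun q hq => hs q (Multiset.mem_cons_of_mem hq), Nat.cast_id]

lemma sum_colLen (lam : n.Partition) : ∑ j ∈ range n, colLen lam j = n :=
  (sum_card_filter_lt n lam.parts fun _ hp => Nat.Partition.le_of_mem_parts hp).trans
    lam.parts_sum

lemma sum_rowLen (lam : n.Partition) {M : ℕ} (hM : n ≤ M) : ∑ i ∈ range M, rowLen lam i = n := by
  have h1 : ∀ i, rowLen lam i = ∑ j ∈ range n, if i < colLen lam j then 1 else 0 := fun i => by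
    rw [sum_boole, Nat.cast_id, rowLen]
  have h2 : ∀ j, ∑ i ∈ range M, (if i < colLen lam j then 1 else 0) = colLen lam j := fun j => by
    have := colLen_le lam j
    rw [sum_boole, Nat.cast_id,
      show {i ∈ range M | i < colLen lam j} = range (colLen lam j) by ext; simp; omega, card_range]
  simp only [h1]
  rw [sum_comm]
  simp only [h2, sum_colLen]

lemma rowLen_injective : Function.Injective (rowLen (n := n)) := fun lam mu h => by
  have hcol : colLen lam = colLen mu := funext fun j => eq_of_forall_lt_iff fun i => by
    rw [← lt_rowLen_iff, ← lt_rowLen_iff, h]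
  have hcount : ∀ (nu : n.Partition) (p : ℕ),
      colLen nu p = colLen nu (p + 1) + nu.parts.count (p + 1) := fun nu p => by
    rw [colLen, colLen, Multiset.count_eq_card_filter_eq, ← Multiset.card_add,
      Multiset.filter_add_filter]
    have h1 : nu.parts.filter (fun q => p + 1 < q ∧ p + 1 = q) = 0 :=
      Multiset.filter_eq_nil.2 fun q _ => by omega
    rw [h1, add_zero]
    congr 1
    exact Multiset.filter_congr fun q _ => by omega
  refine Nat.Partition.ext (Multiset.ext.2 fun p => ?_)
  cases p with
  | zero =>
    rw [Multiset.count_eq_zero_of_notMem fun h => (lam.parts_pos h).ne rfl,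
      Multiset.count_eq_zero_of_notMem fun h => (mu.parts_pos h).ne rfl]
  | succ p =>
    have h1 := hcount lam p
    have h2 := hcount mu p
    rw [hcol] at h1
    omega

/-- The partition with prescribed row lengths (a default value if these do not sum to `n`). -/
def ofRows (n : ℕ) (ρ : ℕ → ℕ) : n.Partition :=
  if h : ((range n).val.map ρ).sum = n then Nat.Partition.ofSums n _ h else default

lemma eq_zero_of_sum_range_le {ρ : ℕ → ℕ} (hρ : Antitone ρ) {M : ℕ} (hM : n < M)
    (hsum : ∑ i ∈ range M, ρ i ≤ n) {i : ℕ} (hi : n ≤ i) : ρ i = 0 := by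
  by_contra h
  have h1 : ∀ k ∈ range (n + 1), 1 ≤ ρ k := fun k hk =>
    (Nat.one_le_iff_ne_zero.2 h).trans (hρ ((Nat.lt_succ_iff.1 (mem_range.1 hk)).trans hi))
  have h2 := card_nsmul_le_sum (range (n + 1)) ρ 1 h1
  have h3 := sum_le_sum_of_subset (f := ρ) (range_subset_range.2 (by omega : n + 1 ≤ M))
  rw [card_range, smul_eq_mul, mul_one] at h2
  exact absurd (h2.trans (h3.trans hsum)) (by omega)

lemma rowLen_ofRows {ρ : ℕ → ℕ} (hρ : Antitone ρ) {M : ℕ} (hM : n < M)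
    (hsum : ∑ i ∈ range M, ρ i = n) : rowLen (ofRows n ρ) = ρ := by
  have h0 : ∀ i, n ≤ i → ρ i = 0 := fun i => eq_zero_of_sum_range_le hρ hM hsum.le
  have hn : ((range n).val.map ρ).sum = n := by
    refine Eq.trans ?_ hsum
    exact sum_subset (range_subset_range.2 hM.le) fun i _ hi => h0 i (by simpa using hi)
  have hcol : ∀ j, colLen (ofRows n ρ) j = #{i ∈ range n | j < ρ i} := fun j => by
    rw [colLen, ofRows, dif_pos hn, Nat.Partition.ofSums, Multiset.filter_filter,
      Multiset.filter_map, Multiset.card_map]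
    rw [Finset.card_def, Finset.filter_val]
    congr 1
    exact Multiset.filter_congr fun i _ => by simp only [Function.comp]; omega
  refine funext fun i => eq_of_forall_lt_iff fun j => ?_
  rw [lt_rowLen_iff, hcol]
  refine lt_card_filter_range_iff (fun a b hab h => h.trans_le (hρ hab)) (fun k h => ?_) i
  by_contra hk
  rw [h0 k (not_lt.1 hk)] at h
  exact Nat.not_lt_zero _ h

/-- Add a box at the end of row `r`. -/
def addBox (lam : n.Partition) (r : ℕ) : (n + 1).Partition := ofRows (n + 1) (addAt (rowLen lam) r)

/-- Remove the last box of row `r`. -/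
def removeBox (lam : (n + 1).Partition) (r : ℕ) : n.Partition :=
  ofRows n (Function.update (rowLen lam) r (rowLen lam r - 1))

/-- The partition still has weakly decreasing rows after adding a box to row `r`. -/
def Addable (lam : n.Partition) (r : ℕ) : Prop := Antitone (addAt (rowLen lam) r)

/-- Row `r` is strictly longer than the next one. -/
def Removable (lam : n.Partition) (r : ℕ) : Prop := rowLen lam (r + 1) < rowLen lam r

lemma Addable.le {lam : n.Partition} {r : ℕ} (h : Addable lam r) : r ≤ n := by
  by_contra hr
  have h1 := h (Nat.sub_le r 1)
  have h2 := rowLen_eq_zero lam (i := r - 1) (by omega)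
  rw [addAt, Function.update_self, Function.update_of_ne (by omega), h2] at h1
  omega

lemma Addable.lt_of_lt {lam : n.Partition} {r i : ℕ} (h : Addable lam r) (hi : i < r) :
    rowLen lam r < rowLen lam i := by
  have := h hi.le
  rwa [addAt, Function.update_self, Function.update_of_ne hi.ne] at this

lemma addable_of_lt {lam : n.Partition} {r : ℕ} (h : ∀ k, r = k + 1 → rowLen lam r < rowLen lam k) :
    Addable lam r := antitone_nat_of_succ_le fun k => by
  have := rowLen_antitone lam (Nat.le_succ k)
  simp only [Nat.succ_eq_add_one] at this
  simp only [addAt, Function.update_apply]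
  split_ifs with h1 h2 h2
  · omega
  · exact h1 ▸ h k h1.symm
  · subst h2; omega
  · exact this

lemma rowLen_addBox {lam : n.Partition} {r : ℕ} (h : Addable lam r) :
    rowLen (addBox lam r) = addAt (rowLen lam) r :=
  rowLen_ofRows (M := n + 2) h (by omega) (by
    rw [sum_addAt (by have := h.le; omega), sum_rowLen lam (by omega)])

lemma rowLen_removeBox {lam : (n + 1).Partition} {r : ℕ} (h : Removable lam r) :
    rowLen (removeBox lam r) = Function.update (rowLen lam) r (rowLen lam r - 1) := by
  unfold Removable at h
  have hr : r < n + 1 := by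
    by_contra hr
    rw [rowLen_eq_zero lam (not_lt.1 hr)] at h
    exact Nat.not_lt_zero _ h
  refine rowLen_ofRows (M := n + 1) (antitone_nat_of_succ_le fun k => ?_) (by omega) ?_
  · have := rowLen_antitone lam (Nat.le_succ k)
    simp only [Nat.succ_eq_add_one] at this
    simp only [Function.update_apply]
    split_ifs with h1 h2 h2
    · omega
    · subst h1; omega
    · subst h2; omega
    · exact this
  · have h1 := sum_rowLen lam le_rfl
    rw [← sum_erase_add _ _ (mem_range.2 hr)] at h1
    rw [sum_update_of_mem (mem_range.2 hr), sdiff_singleton_eq_erase]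
    omega

lemma Addable.removable {lam : n.Partition} {r : ℕ} (h : Addable lam r) :
    Removable (addBox lam r) r := by
  have := rowLen_antitone lam (Nat.le_succ r)
  simp only [Nat.succ_eq_add_one] at this
  rw [Removable, rowLen_addBox h, addAt, Function.update_self, Function.update_of_ne (by omega)]
  omega

lemma Addable.removeBox_addBox {lam : n.Partition} {r : ℕ} (h : Addable lam r) :
    removeBox (addBox lam r) r = lam := rowLen_injective <| by
  rw [rowLen_removeBox h.removable, rowLen_addBox h, addAt]
  simp

lemma Removable.addAt_removeBox {lam : (n + 1).Partition} {r : ℕ} (h : Removable lam r) :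
    addAt (rowLen (removeBox lam r)) r = rowLen lam := by
  rw [rowLen_removeBox h, addAt, Function.update_self, Function.update_idem,
    Nat.sub_add_cancel (Nat.one_le_of_lt h), Function.update_eq_self]

lemma Removable.addable {lam : (n + 1).Partition} {r : ℕ} (h : Removable lam r) :
    Addable (removeBox lam r) r := by
  rw [Addable, h.addAt_removeBox]
  exact rowLen_antitone lam

lemma Removable.addBox_removeBox {lam : (n + 1).Partition} {r : ℕ} (h : Removable lam r) :
    addBox (removeBox lam r) r = lam := rowLen_injective <| by
  rw [rowLen_addBox h.addable, h.addAt_removeBox]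

open Classical in
/-- Summing over ways of removing a box is summing over ways of adding one. -/
lemma sum_removable_eq_sum_addable (M : ℕ) (F : (n + 1).Partition → ℕ → ℝ) :
    ∑ mu : (n + 1).Partition, ∑ r ∈ range M, (if Removable mu r then F mu r else 0) =
      ∑ lam : n.Partition, ∑ r ∈ range M, (if Addable lam r then F (addBox lam r) r else 0) := by
  rw [← sum_product', ← sum_product', ← sum_filter, ← sum_filter]
  symm
  refine sum_bij' (fun x _ => (addBox x.1 x.2, x.2)) (fun x _ => (removeBox x.1 x.2, x.2))
    (fun x hx => ?_) (fun x hx => ?_) (fun x hx => ?_) (fun x hx => ?_) fun x hx => rfl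
  all_goals
    simp only [mem_filter, mem_product, mem_univ, true_and] at hx ⊢
  · exact ⟨hx.1, hx.2.removable⟩
  · exact ⟨hx.1, hx.2.addable⟩
  · exact Prod.ext hx.2.removeBox_addBox rfl
  · exact Prod.ext hx.2.addBox_removeBox rfl

lemma colLen_of_addable {lam : n.Partition} {r : ℕ} (h : Addable lam r) :
    colLen lam (rowLen lam r) = r := eq_of_forall_lt_iff fun i => by
  rw [← lt_rowLen_iff]
  refine ⟨fun hi => ?_, h.lt_of_lt⟩
  by_contra hir
  exact hi.not_ge (rowLen_antitone lam (not_lt.1 hir))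

lemma colLen_addBox {lam : n.Partition} {r : ℕ} (h : Addable lam r) :
    colLen (addBox lam r) = addAt (colLen lam) (rowLen lam r) :=
  funext fun j => eq_of_forall_lt_iff fun i => by
    rw [← lt_rowLen_iff, rowLen_addBox h]
    simp only [addAt, Function.update_apply]
    split_ifs with h1 h2 h2
    · subst h1 h2; rw [colLen_of_addable h]; omega
    · subst h1; rw [← lt_rowLen_iff]; omega
    · subst h2
      rw [colLen_of_addable h]
      refine ⟨fun hi => ?_, fun hi => h.lt_of_lt (by omega)⟩
      by_contra hir
      exact hi.not_ge (rowLen_antitone lam (by omega))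
    · rw [lt_rowLen_iff]

lemma sum_mul_addAt {m r : ℕ} (hr : r < m) (f : ℕ → ℕ) :
    ∑ i ∈ range m, i * addAt f r i = ∑ i ∈ range m, i * f i + r := by
  rw [← sum_erase_add _ _ (mem_range.2 hr), ← sum_erase_add (range m) _ (mem_range.2 hr),
    sum_congr rfl fun i hi => by
      rw [addAt, Function.update_of_ne (ne_of_mem_erase hi)], addAt, Function.update_self]
  ring

lemma nStat_addBox {lam : n.Partition} {r : ℕ} (h : Addable lam r) :
    nStat (addBox lam r) = nStat lam + r := by
  rw [nStat, rowLen_addBox h, sum_mul_addAt (Nat.lt_succ_of_le h.le), sum_range_succ,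
    rowLen_eq_zero lam le_rfl, mul_zero, add_zero, nStat]

lemma nStatConj_addBox {lam : n.Partition} {r : ℕ} (h : Addable lam r) :
    nStatConj (addBox lam r) = nStatConj lam + rowLen lam r := by
  rw [nStatConj, colLen_addBox h, sum_mul_addAt (Nat.lt_succ_of_le (rowLen_le lam r)),
    sum_range_succ, colLen_eq_zero lam le_rfl, mul_zero, add_zero, nStatConj]

/-- The sum of the anisotropic contents of the boxes. -/
noncomputable def contentSum (α : ℝ) (lam : n.Partition) : ℝ := α * nStatConj lam - nStat lam

lemma contentSum_addBox (α : ℝ) {lam : n.Partition} {r : ℕ} (h : Addable lam r) :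
    contentSum α (addBox lam r) = contentSum α lam + edge α (rowLen lam) r := by
  rw [contentSum, nStat_addBox h, nStatConj_addBox h, contentSum, edge]
  push_cast
  ring

end Shapes

section HookRatio

variable {α : ℝ}

/-- The product of the two hook lengths of a box with arm `a` and leg `l`. -/
def hookWeight (α a l : ℝ) : ℝ := (α * a + l + 1) * (α * a + l + α)

lemma hookWeight_pos (hα : 0 < α) (a l : ℕ) : 0 < hookWeight α a l := by
  unfold hookWeight
  positivity

lemma hookWeight_div_mul (hα : 0 < α) (a l : ℕ) {d : ℝ} (hd : d = -(α * (a + 1) + l + 1)) :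
    hookWeight α a (l + 1) / hookWeight α a l * (1 + 1 / d) = 1 + -1 / (d + α) := by
  have h1 : 0 < α * a + l + 1 := by positivity
  have h2 : 0 < α * a + l + α := by positivity
  have h3 : 0 < α * (a + 1) + l + 1 := by positivity
  have h4 : d + α = -(α * a + l + 1) := by rw [hd]; ring
  rw [h4, hd, hookWeight, hookWeight]
  field_simp
  ring

/-- The product of hook lengths `α * (c - x) + k - r` and `α * (c - x) + k - r + α - 1`. -/
def cornerWeight (α c r x k : ℝ) : ℝ :=
  (α * (c - x) + k - r) * (α * (c - x) + k - r + α - 1)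

lemma cornerWeight_pos (hα : 0 < α) {c r x k : ℕ} (hx : x ≤ c) (hk : r < k) :
    0 < cornerWeight α c r x k := by
  have h1 : 0 ≤ α * ((c : ℝ) - x) := mul_nonneg hα.le (sub_nonneg.2 (by exact_mod_cast hx))
  have h2 : (r : ℝ) + 1 ≤ k := by exact_mod_cast hk
  exact mul_pos (by linarith) (by linarith)

lemma prod_Ico_cornerWeight_div (hα : 0 < α) {c r k : ℕ} (hk : r < k) {a b : ℕ} (hab : a ≤ b)
    (hb : b ≤ c) :
    ∏ j ∈ Ico a b, cornerWeight α c r j k / cornerWeight α c r (j + 1) k =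
      cornerWeight α c r a k / cornerWeight α c r b k := by
  induction b, hab using Nat.le_induction with
  | base => rw [Ico_self, prod_empty, div_self (cornerWeight_pos hα hb hk).ne']
  | succ b hab ih =>
    rw [prod_Ico_succ_top hab, ih (by omega), Nat.cast_succ]
    have := (cornerWeight_pos hα (show b ≤ c by omega) hk).ne'
    field_simp

lemma one_add_div_mul_cornerWeight (hα : 0 < α) {ρ : ℕ → ℕ} {r k : ℕ} (hρ : ρ k ≤ ρ r)
    (hk : r < k) :
    (1 + 1 / (edge α ρ r - edge α ρ k)) * cornerWeight α (ρ r) r (ρ k) k =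
      (1 + -1 / (edge α ρ r + α - edge α ρ k)) * cornerWeight α (ρ r) r (ρ k) (k + 1) := by
  have h1 : 0 ≤ α * ((ρ r : ℝ) - ρ k) := mul_nonneg hα.le (sub_nonneg.2 (by exact_mod_cast hρ))
  have h2 : (r : ℝ) + 1 ≤ k := by exact_mod_cast hk
  obtain ⟨d, hd⟩ : ∃ d, d = edge α ρ r - edge α ρ k := ⟨_, rfl⟩
  have e : α * ((ρ r : ℝ) - ρ k) + k - r = d := by rw [hd, edge, edge]; ring
  have h3 : 0 < d := by linarith
  have h4 : 0 < d + α := by linarith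
  have w1 : cornerWeight α (ρ r) r (ρ k) k = d * (d + α - 1) := by rw [cornerWeight, e]
  have w2 : cornerWeight α (ρ r) r (ρ k) (k + 1) = (d + 1) * (d + α) := by
    rw [cornerWeight, ← e]; ring
  rw [show edge α ρ r + α - edge α ρ k = d + α by rw [hd]; ring, ← hd, w1, w2]
  field_simp
  ring

lemma prod_one_add_div_mul_prod_hookWeight_div (hα : 0 < α) {ρ κ : ℕ → ℕ} (hρ : Antitone ρ)
    (hκ : ∀ i j, j < ρ i ↔ i < κ j) (r : ℕ) {k : ℕ} (hk : r ≤ k) :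
    (∏ i ∈ Ico (r + 1) (k + 1), (1 + 1 / (edge α ρ r - edge α ρ i))) *
        (∏ j ∈ Ico (ρ k) (ρ r), cornerWeight α (ρ r) r j (κ j) /
          cornerWeight α (ρ r) r (j + 1) (κ j)) * α =
      (∏ i ∈ Ico (r + 1) (k + 1), (1 + -1 / (edge α ρ r + α - edge α ρ i))) *
        cornerWeight α (ρ r) r (ρ k) (k + 1) := by
  induction k, hk using Nat.le_induction with
  | base => simp [cornerWeight]
  | succ k hk ih =>
    have hs := hρ (Nat.le_succ k)
    have hr := hρ hk
    simp only [Nat.succ_eq_add_one] at hs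
    have hcol : ∏ j ∈ Ico (ρ (k + 1)) (ρ k), cornerWeight α (ρ r) r j (κ j) /
        cornerWeight α (ρ r) r (j + 1) (κ j) =
        cornerWeight α (ρ r) r (ρ (k + 1)) (k + 1 : ℕ) /
          cornerWeight α (ρ r) r (ρ k) (k + 1 : ℕ) := by
      rw [← prod_Ico_cornerWeight_div hα (show r < k + 1 by omega) hs hr]
      refine prod_congr rfl fun j hj => ?_
      have h1 := (hκ k j).1 (mem_Ico.1 hj).2
      have h2 := (hκ (k + 1) j).not.1 (not_lt.2 (mem_Ico.1 hj).1)
      rw [show κ j = k + 1 by omega]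
    have hne := (cornerWeight_pos hα hr (show r < k + 1 by omega)).ne'
    have hstep := one_add_div_mul_cornerWeight hα (hs.trans hr) (show r < k + 1 by omega)
    have htop : ∀ f : ℕ → ℝ, ∏ i ∈ Ico (r + 1) (k + 1 + 1), f i =
        (∏ i ∈ Ico (r + 1) (k + 1), f i) * f (k + 1) := prod_Ico_succ_top (by omega)
    rw [htop, htop, ← prod_Ico_consecutive _ hs hr, hcol]
    push_cast at hne hstep ⊢
    calc _ = ((∏ i ∈ Ico (r + 1) (k + 1), (1 + 1 / (edge α ρ r - edge α ρ i))) *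
        (∏ j ∈ Ico (ρ k) (ρ r), cornerWeight α (ρ r) r j (κ j) /
          cornerWeight α (ρ r) r (j + 1) (κ j)) * α) / cornerWeight α (ρ r) r (ρ k) (k + 1) *
          ((1 + 1 / (edge α ρ r - edge α ρ (k + 1))) *
            cornerWeight α (ρ r) r (ρ (k + 1)) (k + 1)) := by ring
      _ = _ := by
        rw [ih, hstep]
        field_simp

lemma prod_erase_range {M r : ℕ} (hr : r < M) (f : ℕ → ℝ) :
    ∏ k ∈ (range M).erase r, f k = (∏ k ∈ range r, f k) * ∏ k ∈ Ico (r + 1) M, f k := by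
  rw [← prod_union]
  · refine prod_congr (ext fun k => ?_) fun _ _ => rfl
    simp only [mem_erase, mem_union, mem_range, mem_Ico]
    omega
  · refine disjoint_left.2 fun k h1 h2 => ?_
    simp only [mem_range, mem_Ico] at h1 h2
    omega

lemma prod_ratio_mul_upProb (hα : 0 < α) {ρ κ : ℕ → ℕ} (hρ : Antitone ρ)
    (hκ : ∀ i j, j < ρ i ↔ i < κ j) {r M : ℕ} (hr : r < M) (h0 : ρ (M - 1) = 0) (u : ℕ → ℝ)
    (hu : ∀ i < r, u i * (1 + 1 / (edge α ρ r - edge α ρ i)) =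
      1 + -1 / (edge α ρ r + α - edge α ρ i)) :
    α * (∏ i ∈ range r, u i) * (∏ j ∈ range (ρ r), cornerWeight α (ρ r) r j (κ j) /
          cornerWeight α (ρ r) r (j + 1) (κ j)) * upProb α M ρ r =
      downWeight α M (addAt ρ r) r := by
  have h := prod_one_add_div_mul_prod_hookWeight_div hα hρ hκ r (k := M - 1) (by omega)
  rw [h0, Nat.Ico_zero_eq_range, Nat.sub_add_cancel (by omega)] at h
  have hM := (edge_add_pos (ρ := ρ) hα hr).ne'
  have hcorner : cornerWeight α (ρ r) r (0 : ℕ) ((M - 1 : ℕ) + 1) =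
      (edge α ρ r + M) * (edge α ρ r + α - 1 + M) := by
    rw [Nat.cast_sub (by omega : 1 ≤ M), cornerWeight, edge]
    push_cast
    ring
  have hdown : ∏ k ∈ (range M).erase r, (1 + -1 / (edge α (addAt ρ r) r - edge α (addAt ρ r) k))
      = ∏ k ∈ (range M).erase r, (1 + -1 / (edge α ρ r + α - edge α ρ k)) :=
    prod_congr rfl fun k hk => by rw [edge_addAt_self, edge_addAt_of_ne (ne_of_mem_erase hk)]
  rw [upProb, downWeight, residueWeight, residueWeight, hdown, edge_addAt_self,
    prod_erase_range hr, prod_erase_range hr,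
    ← prod_congr rfl fun i hi => hu i (mem_range.1 hi), prod_mul_distrib]
  rw [hcorner] at h
  rw [mul_div_assoc', div_eq_iff hM]
  linear_combination (∏ i ∈ range r, u i) *
    (∏ i ∈ range r, (1 + 1 / (edge α ρ r - edge α ρ i))) * h

end HookRatio

section JackMeasure

variable {α : ℝ} {n : ℕ}

lemma mem_cells (lam : n.Partition) (s : ℕ × ℕ) : s ∈ cells lam ↔ s.2 < rowLen lam s.1 := by
  rw [cells, mem_filter, mem_product, mem_range, mem_range, and_iff_right_iff_imp]
  intro h
  refine ⟨?_, h.trans_le (rowLen_le lam _)⟩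
  by_contra hs
  rw [rowLen_eq_zero lam (not_lt.1 hs)] at h
  exact Nat.not_lt_zero _ h

/-- The product of all hook lengths. -/
noncomputable def hookProd (α : ℝ) (lam : n.Partition) : ℝ :=
  ∏ s ∈ cells lam, hookWeight α (arm lam s) (leg lam s)

lemma cLow_mul_cUp (lam : n.Partition) : cLow α lam * cUp α lam = hookProd α lam :=
  prod_mul_distrib.symm

lemma hookProd_pos (hα : 0 < α) (lam : n.Partition) : 0 < hookProd α lam :=
  prod_pos fun _ _ => hookWeight_pos hα _ _

lemma cells_addBox {lam : n.Partition} {r : ℕ} (h : Addable lam r) :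
    cells (addBox lam r) = insert (r, rowLen lam r) (cells lam) := ext fun s => by
  rw [mem_insert, mem_cells, mem_cells, rowLen_addBox h, addAt, Function.update_apply,
    Prod.ext_iff]
  split_ifs with hs
  · rw [hs]; simp only [true_and]; omega
  · simp [hs]

lemma prod_cells_eq {lam : n.Partition} {r : ℕ} (h : Addable lam r) (f : ℕ × ℕ → ℝ)
    (hf : ∀ s ∈ cells lam, s.1 ≠ r → s.2 ≠ rowLen lam r → f s = 1) :
    ∏ s ∈ cells lam, f s =
      (∏ i ∈ range r, f (i, rowLen lam r)) * ∏ j ∈ range (rowLen lam r), f (r, j) := by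
  rw [← prod_filter_mul_prod_filter_not (cells lam) (fun s => s.2 = rowLen lam r)]
  congr 1
  · symm
    refine prod_bij (fun i _ => (i, rowLen lam r)) (fun i hi => ?_) (fun i _ j _ hij => ?_)
      (fun s hs => ?_) fun _ _ => rfl
    · exact mem_filter.2 ⟨(mem_cells _ _).2 (h.lt_of_lt (mem_range.1 hi)), rfl⟩
    · exact (Prod.ext_iff.1 hij).1
    · obtain ⟨h1, h2⟩ := mem_filter.1 hs
      rw [mem_cells, h2, lt_rowLen_iff, colLen_of_addable h] at h1
      exact ⟨s.1, mem_range.2 h1, Prod.ext rfl h2.symm⟩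
  · rw [← prod_filter_mul_prod_filter_not _ (fun s => s.1 = r)]
    conv_rhs => rw [← mul_one (∏ j ∈ range (rowLen lam r), f (r, j))]
    congr 1
    · symm
      refine prod_bij (fun j _ => (r, j)) (fun j hj => ?_) (fun i _ j _ hij => ?_)
        (fun s hs => ?_) fun _ _ => rfl
      · have hj := mem_range.1 hj
        exact mem_filter.2 ⟨mem_filter.2 ⟨(mem_cells _ _).2 hj, hj.ne⟩, rfl⟩
      · exact (Prod.ext_iff.1 hij).2
      · obtain ⟨h1, h2⟩ := mem_filter.1 hs
        have h1 := (mem_filter.1 h1).1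
        rw [mem_cells, h2] at h1
        exact ⟨s.2, mem_range.2 h1, Prod.ext h2.symm rfl⟩
    · refine prod_eq_one fun s hs => ?_
      obtain ⟨h1, h2⟩ := mem_filter.1 hs
      obtain ⟨h1, h3⟩ := mem_filter.1 h1
      exact hf s h1 h2 h3

/-- The up and down transition weights are reversible with respect to the hook products. -/
lemma hookProd_addBox_mul_upProb (hα : 0 < α) {lam : n.Partition} {r M : ℕ} (h : Addable lam r)
    (hM : n < M) :
    hookProd α (addBox lam r) * upProb α M (rowLen lam) r =
      hookProd α lam * downWeight α M (rowLen (addBox lam r)) r := by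
  have hr := h.le
  have hne : ∀ s, hookWeight α (arm lam s) (leg lam s) ≠ 0 := fun s => (hookWeight_pos hα _ _).ne'
  set R : ℕ × ℕ → ℝ := fun s => hookWeight α (arm (addBox lam r) s) (leg (addBox lam r) s) /
    hookWeight α (arm lam s) (leg lam s) with hR
  have hleg : ∀ s : ℕ × ℕ, s.2 ≠ rowLen lam r → leg (addBox lam r) s = leg lam s := fun s hs => by
    rw [leg, leg, colLen_addBox h, addAt, Function.update_of_ne hs]
  have harm : ∀ s : ℕ × ℕ, s.1 ≠ r → arm (addBox lam r) s = arm lam s := fun s hs => by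
    rw [arm, arm, rowLen_addBox h, addAt, Function.update_of_ne hs]
  have hnew : hookWeight α (arm (addBox lam r) (r, rowLen lam r))
      (leg (addBox lam r) (r, rowLen lam r)) = α := by
    rw [arm, leg, rowLen_addBox h, colLen_addBox h, addAt, addAt, Function.update_self,
      Function.update_self, colLen_of_addable h]
    simp [hookWeight]
  have hprod : hookProd α (addBox lam r) = α * (hookProd α lam * ∏ s ∈ cells lam, R s) := by
    rw [hookProd, cells_addBox h, prod_insert (by simp [mem_cells]), hnew, hookProd,
      ← prod_mul_distrib]
    exact congrArg _ (prod_congr rfl fun s _ => (mul_div_cancel₀ _ (hne s)).symm)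
  have hRone : ∀ s ∈ cells lam, s.1 ≠ r → s.2 ≠ rowLen lam r → R s = 1 := fun s _ h1 h2 => by
    simp only [hR]
    rw [harm s h1, hleg s h2, div_self (hne s)]
  have hRcol : ∀ i < r, R (i, rowLen lam r) *
      (1 + 1 / (edge α (rowLen lam) r - edge α (rowLen lam) i)) =
      1 + -1 / (edge α (rowLen lam) r + α - edge α (rowLen lam) i) := fun i hi => by
    have hlt := h.lt_of_lt hi
    have h1 : leg (addBox lam r) (i, rowLen lam r) = leg lam (i, rowLen lam r) + 1 := by
      rw [leg, leg, colLen_addBox h, addAt, Function.update_self, colLen_of_addable h]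
      simp only
      omega
    have ha : (arm lam (i, rowLen lam r) : ℝ) = rowLen lam i - rowLen lam r - 1 := by
      rw [arm, Nat.cast_sub (by simp only; omega)]; push_cast; ring
    have hl : (leg lam (i, rowLen lam r) : ℝ) = r - i - 1 := by
      rw [leg, colLen_of_addable h, Nat.cast_sub (by simp only; omega)]; push_cast; ring
    simp only [hR]
    rw [harm _ hi.ne, h1, add_sub_right_comm, Nat.cast_succ]
    exact hookWeight_div_mul hα _ _ (by rw [ha, hl, edge, edge]; ring)
  have hRrow : ∏ j ∈ range (rowLen lam r), R (r, j) = ∏ j ∈ range (rowLen lam r),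
      cornerWeight α (rowLen lam r) r j (colLen lam j) /
        cornerWeight α (rowLen lam r) r (j + 1) (colLen lam j) := by
    refine prod_congr rfl fun j hj => ?_
    have hj := mem_range.1 hj
    have hc := (lt_rowLen_iff lam r j).1 hj
    have ha' : (arm (addBox lam r) (r, j) : ℝ) = rowLen lam r - j := by
      rw [arm, rowLen_addBox h, addAt, Function.update_self, Nat.cast_sub (by simp only; omega)]
      push_cast; ring
    have ha : (arm lam (r, j) : ℝ) = rowLen lam r - j - 1 := by
      rw [arm, Nat.cast_sub (by simp only; omega)]; push_cast; ring
    have hl : (leg lam (r, j) : ℝ) = colLen lam j - r - 1 := by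
      rw [leg, Nat.cast_sub (by simp only; omega)]; push_cast; ring
    simp only [hR]
    rw [hleg _ hj.ne, ha', ha, hl, hookWeight, hookWeight, cornerWeight, cornerWeight]
    congr 1 <;> ring
  have key := prod_ratio_mul_upProb hα (rowLen_antitone lam) (lt_rowLen_iff lam)
    (show r < M by omega) (rowLen_eq_zero lam (by omega)) (fun i => R (i, rowLen lam r)) hRcol
  rw [hprod, rowLen_addBox h, ← key, prod_cells_eq h R hRone, hRrow]
  ring

lemma jackP_eq (α : ℝ) (lam : n.Partition) :
    jackP α lam = α ^ n * n.factorial / hookProd α lam := by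
  rw [jackP, cLow_mul_cUp]

lemma jackP_nonneg (hα : 0 < α) (lam : n.Partition) : 0 ≤ jackP α lam := by
  rw [jackP_eq]
  exact div_nonneg (by positivity) (hookProd_pos hα lam).le

lemma jackP_addBox_mul_downWeight (hα : 0 < α) {lam : n.Partition} {r M : ℕ} (h : Addable lam r)
    (hM : n < M) :
    jackP α (addBox lam r) * downWeight α M (rowLen (addBox lam r)) r =
      α * (n + 1) * (jackP α lam * upProb α M (rowLen lam) r) := by
  have h1 := (hookProd_pos hα lam).ne'
  have h2 := (hookProd_pos hα (addBox lam r)).ne'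
  have h3 := hookProd_addBox_mul_upProb hα h hM
  rw [jackP_eq, jackP_eq, Nat.factorial_succ]
  push_cast
  field_simp
  linear_combination (-(α ^ (n + 1))) * h3

lemma upProb_eq_zero_of_not_addable {lam : n.Partition} {r M : ℕ} (hr : r < M)
    (h : ¬Addable lam r) : upProb α M (rowLen lam) r = 0 := by
  by_contra hne
  refine h (addable_of_lt fun k hk => ?_)
  subst hk
  refine lt_of_le_of_ne (rowLen_antitone lam (Nat.le_succ k)) fun heq => hne ?_
  exact upProb_eq_zero hr heq.symm

lemma downWeight_eq_zero_of_not_removable {lam : n.Partition} {r M : ℕ} (hr : r < M) (hM : n < M)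
    (h : ¬Removable lam r) : downWeight α M (rowLen lam) r = 0 :=
  downWeight_eq_zero hr (le_antisymm (not_lt.1 h) (rowLen_antitone lam (Nat.le_succ r)))
    (rowLen_eq_zero lam (by omega))

/-- The Jack measures are coherent with respect to the up transition probabilities. -/
lemma sum_jackP_succ (hα : 0 < α) {M : ℕ} (hM : n + 1 < M) (g : (n + 1).Partition → ℝ) :
    ∑ mu : (n + 1).Partition, jackP α mu * g mu =
      ∑ lam : n.Partition, jackP α lam *
        ∑ r ∈ range M, upProb α M (rowLen lam) r * g (addBox lam r) := by
  classical
  have hn : α * ((n : ℝ) + 1) ≠ 0 := by positivity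
  have hdown : ∀ mu : (n + 1).Partition, α * ((n : ℝ) + 1) * (jackP α mu * g mu) =
      ∑ r ∈ range M, if Removable mu r then
        jackP α mu * downWeight α M (rowLen mu) r * g mu else 0 := fun mu => by
    have h := sum_downWeight (M := M) hα (rowLen_antitone mu)
    rw [sum_rowLen mu hM.le] at h
    push_cast at h
    rw [← h, sum_mul]
    refine sum_congr rfl fun r hr => ?_
    split_ifs with hrem
    · ring
    · rw [downWeight_eq_zero_of_not_removable (mem_range.1 hr) hM hrem, zero_mul]
  refine mul_left_cancel₀ hn ?_
  rw [mul_sum, sum_congr rfl fun mu _ => hdown mu, sum_removable_eq_sum_addable, mul_sum]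
  refine sum_congr rfl fun lam _ => ?_
  rw [mul_sum, mul_sum]
  refine sum_congr rfl fun r hr => ?_
  split_ifs with hadd
  · rw [jackP_addBox_mul_downWeight hα hadd (by omega)]
    ring
  · rw [upProb_eq_zero_of_not_addable (mem_range.1 hr) hadd, zero_mul, mul_zero, mul_zero]

lemma sum_jackP (hα : 0 < α) (n : ℕ) : ∑ lam : n.Partition, jackP α lam = 1 := by
  induction n with
  | zero => simp [jackP, cLow, cUp, cells]
  | succ n ih =>
    have h := sum_jackP_succ (n := n) hα (show n + 1 < n + 2 by omega) fun _ => 1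
    simp only [mul_one] at h
    rw [h, ← ih]
    refine sum_congr rfl fun lam _ => ?_
    rw [sum_upProb hα (rowLen_antitone lam) (by omega) (rowLen_eq_zero lam (by omega)), mul_one]

/-- The expected fourth moment of the content of the added box. -/
lemma sum_jackP_mul_fourthMoment (hα : 0 < α) {n M : ℕ} (hM : n + 1 < M) :
    ∑ lam : n.Partition, jackP α lam * fourthMoment α M (rowLen lam) =
      2 * α ^ 2 * (n * (n - 1)) + α * (α ^ 2 - α + 1) * n := by
  induction n with
  | zero =>
    have h0 : ∀ lam : (0 : ℕ).Partition, fourthMoment α M (rowLen lam) = 0 := fun lam => by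
      have h := sum_upProb_mul_edge_sq hα (rowLen_antitone lam) (by omega : 0 < M)
        (rowLen_eq_zero lam (Nat.zero_le _))
      rw [sum_rowLen lam (Nat.zero_le _), Nat.cast_zero, mul_zero,
        sum_eq_zero_iff_of_nonneg fun r hr => mul_nonneg
          (upProb_nonneg hα (rowLen_antitone lam) (mem_range.1 hr)) (sq_nonneg _)] at h
      exact sum_eq_zero fun r hr => by linear_combination edge α (rowLen lam) r ^ 2 * h r hr
    simp [h0]
  | succ n ih =>
    have hin : ∀ lam : n.Partition, ∑ r ∈ range M, upProb α M (rowLen lam) r *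
        fourthMoment α M (rowLen (addBox lam r)) =
        fourthMoment α M (rowLen lam) + α * (4 * α * n + α ^ 2 - α + 1) := fun lam => by
      have hz : rowLen lam (M - 1) = 0 := rowLen_eq_zero lam (by omega)
      have m0 := sum_upProb hα (rowLen_antitone lam) (by omega : 0 < M) hz
      have m1 := sum_upProb_mul_edge hα (rowLen_antitone lam) (by omega : 0 < M) hz
      have m2 := sum_upProb_mul_edge_sq hα (rowLen_antitone lam) (by omega : 0 < M) hz
      rw [sum_rowLen lam (by omega)] at m2
      have hterm : ∀ r ∈ range M, upProb α M (rowLen lam) r *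
          fourthMoment α M (rowLen (addBox lam r)) =
          (fourthMoment α M (rowLen lam) + α * (α ^ 2 - α + 1 + α * n)) *
            upProb α M (rowLen lam) r + 3 * α * (α - 1) *
            (upProb α M (rowLen lam) r * edge α (rowLen lam) r) + 3 * α *
            (upProb α M (rowLen lam) r * edge α (rowLen lam) r ^ 2) := fun r hr => by
        by_cases hadd : Addable lam r
        · have hrn := hadd.le
          rw [rowLen_addBox hadd, fourthMoment_addAt hα (rowLen_antitone lam) (mem_range.1 hr)
            hadd hz (by rw [addAt, Function.update_of_ne (by omega), hz]),
            sum_rowLen lam (by omega)]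
          ring
        · rw [upProb_eq_zero_of_not_addable (mem_range.1 hr) hadd]
          ring
      rw [sum_congr rfl hterm, sum_add_distrib, sum_add_distrib, ← mul_sum, ← mul_sum, ← mul_sum,
        m0, m1, m2]
      ring
    rw [sum_jackP_succ hα (by omega : n + 1 < M) fun mu => fourthMoment α M (rowLen mu),
      sum_congr rfl fun lam _ => congrArg _ (hin lam)]
    simp only [mul_add (jackP _ _), sum_add_distrib, ← sum_mul, sum_jackP hα n, ih (by omega)]
    push_cast
    ring

end JackMeasure

section Lindeberg

variable {α : ℝ} {n : ℕ}

/-- The distribution function of the content sum under the Jack measure, convolved with a centred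
Gaussian of variance `v`. -/
noncomputable def smoothedCdf (α : ℝ) (n : ℕ) (v x : ℝ) : ℝ :=
  ∑ lam : n.Partition, jackP α lam * Phi ((x - contentSum α lam) / √v)

lemma smoothedCdf_zero (α v x : ℝ) : smoothedCdf α 0 v x = Phi (x / √v) := by
  simp [smoothedCdf, jackP, cLow, cUp, cells, contentSum, nStat, nStatConj]

lemma abs_pow_three_le {s : ℝ} (hs : 0 < s) (x : ℝ) :
    |x| ^ 3 ≤ (s * x ^ 2 + x ^ 4 / s) / 2 := by
  have h : 0 ≤ x ^ 2 * (|x| - s) ^ 2 / s := by positivity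
  have h2 : x ^ 2 * (|x| - s) ^ 2 / s = s * x ^ 2 + x ^ 4 / s - 2 * |x| ^ 3 := by
    rw [← sq_abs x, show x ^ 4 = |x| ^ 4 by rw [pow_abs, abs_of_nonneg (by positivity)]]
    field_simp
    ring
  linarith

lemma sum_jackP_mul_abs_cube_le (hα : 1 ≤ α) {M : ℕ} (hM : n + 1 < M) :
    ∑ lam : n.Partition, jackP α lam *
        ∑ r ∈ range M, upProb α M (rowLen lam) r * |edge α (rowLen lam) r| ^ 3 ≤
      2 * α ^ 3 * √(n + 1) ^ 3 := by
  have h0 : 0 < α := one_pos.trans_le hα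
  have hs : 0 < √((n : ℝ) + 1) := Real.sqrt_pos.2 (by positivity)
  have hs2 : √((n : ℝ) + 1) ^ 2 = n + 1 := Real.sq_sqrt (by positivity)
  set s := √((n : ℝ) + 1)
  have hlam : ∀ lam : n.Partition,
      ∑ r ∈ range M, upProb α M (rowLen lam) r * |edge α (rowLen lam) r| ^ 3 ≤
        s * (α * n) / 2 + fourthMoment α M (rowLen lam) / (2 * s) := fun lam => by
    have m2 := sum_upProb_mul_edge_sq h0 (rowLen_antitone lam) (by omega : 0 < M)
      (rowLen_eq_zero lam (by omega))
    rw [sum_rowLen lam (by omega)] at m2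
    calc _ ≤ ∑ r ∈ range M, (s / 2 * (upProb α M (rowLen lam) r * edge α (rowLen lam) r ^ 2) +
          (upProb α M (rowLen lam) r * edge α (rowLen lam) r ^ 4) / (2 * s)) := by
          refine sum_le_sum fun r hr => ?_
          have h := mul_le_mul_of_nonneg_left (abs_pow_three_le hs (edge α (rowLen lam) r))
            (upProb_nonneg h0 (rowLen_antitone lam) (mem_range.1 hr))
          refine h.trans_eq ?_
          field_simp
      _ = _ := by
          rw [sum_add_distrib, ← mul_sum, ← sum_div, m2, fourthMoment]
          ring
  calc _ ≤ ∑ lam : n.Partition, jackP α lam *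
        (s * (α * n) / 2 + fourthMoment α M (rowLen lam) / (2 * s)) :=
        sum_le_sum fun lam _ => mul_le_mul_of_nonneg_left (hlam lam) (jackP_nonneg h0 lam)
    _ = s * (α * n) / 2 +
        (2 * α ^ 2 * (n * (n - 1)) + α * (α ^ 2 - α + 1) * n) / (2 * s) := by
        simp only [mul_add (jackP _ _), sum_add_distrib, ← sum_mul, sum_jackP h0, one_mul,
          mul_div_assoc' (jackP _ _) (fourthMoment _ _ _)]
        rw [← sum_div, sum_jackP_mul_fourthMoment h0 hM]
    _ ≤ s * (α ^ 3 * s ^ 2) / 2 + (3 * α ^ 3 * s ^ 4) / (2 * s) := by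
        have hn : (0 : ℝ) ≤ n := n.cast_nonneg
        have h1 : α ≤ α ^ 3 := le_self_pow₀ hα (by norm_num)
        have h2 : α ^ 2 ≤ α ^ 3 := pow_le_pow_right₀ hα (by norm_num)
        have h3 : α * n ≤ α ^ 3 * s ^ 2 := by rw [hs2]; gcongr; linarith
        have h4 : 2 * α ^ 2 * (n * ((n : ℝ) - 1)) + α * (α ^ 2 - α + 1) * n ≤
            3 * α ^ 3 * s ^ 4 := by
          rw [show s ^ 4 = (s ^ 2) ^ 2 by ring, hs2]
          have h5 : α ^ 2 * (n * ((n : ℝ) - 1)) ≤ α ^ 3 * (n + 1) ^ 2 :=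
            (mul_le_mul_of_nonneg_left (by nlinarith) (sq_nonneg α)).trans
              (mul_le_mul_of_nonneg_right h2 (sq_nonneg ((n : ℝ) + 1)))
          have h6 : α * (α ^ 2 - α + 1) * n ≤ α ^ 3 * (n + 1) ^ 2 :=
            mul_le_mul (by nlinarith) (by nlinarith) hn (by positivity)
          linarith
        gcongr
    _ = 2 * α ^ 3 * s ^ 3 := by
        field_simp
        ring

/-- Replacing the last added box by a Gaussian of the same variance. -/
lemma abs_smoothedCdf_succ_sub_le (hα : 1 ≤ α) (n : ℕ) {v : ℝ} (hv : 0 < v) (x : ℝ) :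
    |smoothedCdf α (n + 1) v x - smoothedCdf α n (v + α * n) x| ≤
      4 * α ^ 3 * (√(n + 1) / √v) ^ 3 + 3 * (α * n / v) ^ 2 := by
  have h0 : 0 < α := one_pos.trans_le hα
  obtain ⟨M, hM⟩ : ∃ M, n + 1 < M := ⟨n + 2, by omega⟩
  have hlam : ∀ lam : n.Partition,
      |∑ r ∈ range M, upProb α M (rowLen lam) r *
          Phi ((x - contentSum α (addBox lam r)) / √v) -
          Phi ((x - contentSum α lam) / √(v + α * n))| ≤
        2 * (∑ r ∈ range M, upProb α M (rowLen lam) r * |edge α (rowLen lam) r| ^ 3) / √v ^ 3 +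
          3 * (α * n) ^ 2 / v ^ 2 := fun lam => by
    have hz : rowLen lam (M - 1) = 0 := rowLen_eq_zero lam (by omega)
    have m2 := sum_upProb_mul_edge_sq h0 (rowLen_antitone lam) (by omega : 0 < M) hz
    rw [sum_rowLen lam (by omega)] at m2
    have h := abs_sum_Phi_sub_le (range M) (upProb α M (rowLen lam)) (edge α (rowLen lam))
      (fun r hr => upProb_nonneg h0 (rowLen_antitone lam) (mem_range.1 hr))
      (sum_upProb h0 (rowLen_antitone lam) (by omega : 0 < M) hz)
      (sum_upProb_mul_edge h0 (rowLen_antitone lam) (by omega : 0 < M) hz)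
      m2 (x - contentSum α lam) hv
    rwa [sum_congr rfl fun r hr => ?_]
    by_cases hadd : Addable lam r
    · rw [contentSum_addBox α hadd, sub_sub]
    · rw [upProb_eq_zero_of_not_addable (mem_range.1 hr) hadd, zero_mul, zero_mul]
  have h3 := sum_jackP_mul_abs_cube_le hα hM
  rw [smoothedCdf, smoothedCdf, sum_jackP_succ h0 hM fun mu =>
    Phi ((x - contentSum α mu) / √v), ← sum_sub_distrib]
  calc _ ≤ ∑ lam : n.Partition, jackP α lam *
        (2 * (∑ r ∈ range M, upProb α M (rowLen lam) r * |edge α (rowLen lam) r| ^ 3) / √v ^ 3 +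
          3 * (α * n) ^ 2 / v ^ 2) := by
        refine (abs_sum_le_sum_abs _ _).trans (sum_le_sum fun lam _ => ?_)
        rw [← mul_sub, abs_mul, abs_of_nonneg (jackP_nonneg h0 lam)]
        exact mul_le_mul_of_nonneg_left (hlam lam) (jackP_nonneg h0 lam)
    _ = 2 * (∑ lam : n.Partition, jackP α lam *
          ∑ r ∈ range M, upProb α M (rowLen lam) r * |edge α (rowLen lam) r| ^ 3) / √v ^ 3 +
          3 * (α * n) ^ 2 / v ^ 2 := by
        simp only [mul_add (jackP _ _), sum_add_distrib, ← sum_mul, sum_jackP h0, one_mul]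
        congr 1
        rw [mul_sum, sum_div]
        exact sum_congr rfl fun _ _ => by ring
    _ ≤ 2 * (2 * α ^ 3 * √(n + 1) ^ 3) / √v ^ 3 + 3 * (α * n) ^ 2 / v ^ 2 := by gcongr
    _ = _ := by rw [div_pow, div_pow]; ring

lemma one_div_sqrt_pow_three_le {y : ℝ} (hy : 1 ≤ y) :
    1 / √y ^ 3 ≤ 4 * (1 / √y - 1 / √(y + 1)) := by
  have h1 : 1 ≤ √y := Real.one_le_sqrt.2 hy
  have h2 : √y ≤ √(y + 1) := Real.sqrt_le_sqrt (by linarith)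
  have e1 : √y ^ 2 = y := Real.sq_sqrt (by linarith)
  have e2 : √(y + 1) ^ 2 = y + 1 := Real.sq_sqrt (by linarith)
  set a := √y
  set b := √(y + 1)
  have ha : 0 < a := by linarith
  have hb : 0 < b := by linarith
  have h3 : b ≤ 3 / 2 * a := by
    refine le_of_sq_le_sq ?_ (by positivity)
    nlinarith
  have h4 : 1 / a - 1 / b = 1 / (a * b * (a + b)) := by
    have h5 : (b - a) * (a + b) = 1 := by nlinarith
    field_simp
    linarith
  rw [h4, mul_one_div, div_le_div_iff₀ (by positivity) (by positivity)]
  have h6 : b * (a + b) ≤ 3 / 2 * a * (5 / 2 * a) :=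
    mul_le_mul h3 (by linarith) (by positivity) (by positivity)
  nlinarith [mul_le_mul_of_nonneg_left h6 ha.le, pow_pos ha 3]

/-- The variance of the Gaussian component after `k` of `N` boxes have been added. -/
noncomputable def residualVar (α : ℝ) (N k : ℕ) : ℝ :=
  α * (N * √N + (N * (N - 1) - k * (k - 1))) / 2

lemma le_residualVar (hα : 0 ≤ α) {N k : ℕ} (hk : k + 1 ≤ N) :
    α * N * (√N + (N - (k + 1))) / 2 ≤ residualVar α N (k + 1) := by
  have h1 : (k : ℝ) + 1 ≤ N := by exact_mod_cast hk
  have h2 : 0 ≤ α * (((N : ℝ) - (k + 1)) * k) :=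
    mul_nonneg hα (mul_nonneg (by linarith) k.cast_nonneg)
  rw [residualVar]
  push_cast
  linarith

lemma abs_smoothedCdf_residualVar_succ_sub_le (hα : 1 ≤ α) {N k : ℕ} (hk : k + 1 ≤ N) (x : ℝ) :
    |smoothedCdf α (k + 1) (residualVar α N (k + 1)) x - smoothedCdf α k (residualVar α N k) x| ≤
      (16 * α ^ 3 + 12) * (1 / √(√N + (N - (k + 1))) ^ 3) := by
  have h0 : 0 < α := one_pos.trans_le hα
  have hkN : (k : ℝ) + 1 ≤ N := by exact_mod_cast hk
  have hk0 : (0 : ℝ) ≤ k := k.cast_nonneg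
  have hN : 1 ≤ √(N : ℝ) := Real.one_le_sqrt.2 (by linarith)
  have hV := le_residualVar h0.le hk
  set y := √(N : ℝ) + (N - (k + 1)) with hy
  have hy1 : 1 ≤ y := by linarith
  have hsy : 1 ≤ √y := Real.one_le_sqrt.2 hy1
  have hVpos : 0 < residualVar α N (k + 1) :=
    lt_of_lt_of_le (by have : (0 : ℝ) < N := by linarith
                       positivity) hV
  have h := abs_smoothedCdf_succ_sub_le hα k hVpos x
  rw [show residualVar α N (k + 1) + α * k = residualVar α N k by
    rw [residualVar, residualVar]; push_cast; ring] at h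
  set V := residualVar α N (k + 1)
  have hNV : α * N / V ≤ 2 / y := by
    rw [div_le_div_iff₀ hVpos (by linarith)]
    linarith
  have hkV : (k + 1) / V ≤ 2 / y := by
    refine le_trans ?_ hNV
    gcongr
    nlinarith
  have h1 : (√((k : ℝ) + 1) / √V) ^ 3 ≤ 4 * (1 / √y ^ 3) := by
    rw [← Real.sqrt_div' _ hVpos.le]
    have h2 : √(2 : ℝ) ^ 3 ≤ 4 := by
      have e : √(2 : ℝ) ^ 2 = 2 := Real.sq_sqrt (by norm_num)
      nlinarith [Real.sqrt_nonneg 2]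
    calc √(((k : ℝ) + 1) / V) ^ 3 ≤ √(2 / y) ^ 3 :=
          pow_le_pow_left₀ (Real.sqrt_nonneg _) (Real.sqrt_le_sqrt hkV) 3
      _ = √2 ^ 3 * (1 / √y ^ 3) := by
          rw [Real.sqrt_div' _ (by linarith), div_pow, mul_one_div]
      _ ≤ 4 * (1 / √y ^ 3) := by gcongr
  have h2 : (α * k / V) ^ 2 ≤ 4 * (1 / √y ^ 3) := by
    have h3 : α * k / V ≤ 2 / y := by
      refine le_trans ?_ hNV
      gcongr
      linarith
    calc (α * k / V) ^ 2 ≤ (2 / y) ^ 2 := pow_le_pow_left₀ (by positivity) h3 2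
      _ = 4 * (1 / √y ^ 4) := by
          rw [show √y ^ 4 = (√y ^ 2) ^ 2 by ring, Real.sq_sqrt (by linarith),
            div_pow, mul_one_div]
          norm_num
      _ ≤ 4 * (1 / √y ^ 3) := by
          gcongr
          norm_num
  calc _ ≤ _ := h
    _ ≤ 4 * α ^ 3 * (4 * (1 / √y ^ 3)) + 3 * (4 * (1 / √y ^ 3)) := by gcongr
    _ = _ := by ring

lemma abs_smoothedCdf_sub_Phi_le (hα : 1 ≤ α) {N : ℕ} (hN : 1 ≤ N) (x : ℝ) :
    |smoothedCdf α N (residualVar α N N) x - Phi (x / √(residualVar α N 0))| ≤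
      4 * (16 * α ^ 3 + 12) / √√N := by
  have hN1 : (1 : ℝ) ≤ N := by exact_mod_cast hN
  have hs : 1 ≤ √(N : ℝ) := Real.one_le_sqrt.2 hN1
  have hC : 0 ≤ 16 * α ^ 3 + 12 := by positivity
  have key : ∀ m ≤ N,
      |smoothedCdf α m (residualVar α N m) x - Phi (x / √(residualVar α N 0))| ≤
        4 * (16 * α ^ 3 + 12) * (1 / √(√N + (N - m)) - 1 / √(√N + N)) := fun m => by
    induction m with
    | zero => simp [smoothedCdf_zero]
    | succ m ih =>
      intro hm
      have hmN : (m : ℝ) + 1 ≤ N := by exact_mod_cast hm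
      have h1 := abs_smoothedCdf_residualVar_succ_sub_le hα hm x
      have h2 := one_div_sqrt_pow_three_le (y := √(N : ℝ) + (N - (m + 1))) (by linarith)
      rw [show √(N : ℝ) + (N - (m + 1)) + 1 = √(N : ℝ) + (N - m) by ring] at h2
      have h3 := mul_le_mul_of_nonneg_left h2 hC
      have h4 := ih (by omega)
      push_cast
      refine (abs_sub_le _ _ _).trans ((add_le_add h1 h4).trans ?_)
      linarith
  refine (key N le_rfl).trans ?_
  rw [sub_self, add_zero, mul_sub, mul_one_div]
  have : 0 ≤ 4 * (16 * α ^ 3 + 12) * (1 / √(√(N : ℝ) + N)) := by positivity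
  linarith

/-- The rate of convergence for the unnormalized content sum. -/
lemma abs_cdf_contentSum_sub_Phi_le (hα : 1 ≤ α) {N : ℕ} (hN : 2 ≤ N) (x : ℝ) :
    |(∑ lam : N.Partition, if contentSum α lam ≤ x then jackP α lam else 0) -
        Phi (x / √(α * N.choose 2))| ≤ (52 * (16 * α ^ 3 + 12) + 26) / √√N := by
  have h0 : 0 < α := one_pos.trans_le hα
  have hN2 : (2 : ℝ) ≤ N := by exact_mod_cast hN
  have hs : 1 ≤ √(N : ℝ) := Real.one_le_sqrt.2 (by linarith)
  have hss : 1 ≤ √√(N : ℝ) := Real.one_le_sqrt.2 hs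
  have hs2 : √(N : ℝ) ^ 2 = N := Real.sq_sqrt (by linarith)
  have hss2 : √√(N : ℝ) ^ 2 = √N := Real.sq_sqrt (by linarith)
  set B := residualVar α N N with hB
  set T := residualVar α N 0 with hT
  set σ := α * N.choose 2 with hσ
  have eσ : σ = α * (N * (N - 1)) / 2 := by rw [hσ, Nat.cast_choose_two]; ring
  have eB : B = α * (N * √N) / 2 := by rw [hB, residualVar]; ring
  have eT : T = σ + B := by rw [hT, residualVar, eσ, eB]; push_cast; ring
  have hB0 : 0 < B := by rw [eB]; positivity
  have hσ0 : 0 < σ := by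
    rw [eσ]
    have : 0 < (N : ℝ) * (N - 1) := mul_pos (by linarith) (by linarith)
    positivity
  have hratio : B / σ ≤ 2 / √N := by
    rw [div_le_div_iff₀ hσ0 (by linarith), eB, eσ,
      show α * (N * √N) / 2 * √N = α * N * √(N : ℝ) ^ 2 / 2 by ring, hs2]
    have : 0 ≤ α * N * ((N : ℝ) - 2) := mul_nonneg (by positivity) (by linarith)
    linarith
  have hbT : √B / √T ≤ 2 / √√N := by
    have h1 : B / T ≤ 2 / √N :=
      (div_le_div_of_nonneg_left hB0.le hσ0 (by linarith)).trans hratio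
    rw [← Real.sqrt_div hB0.le]
    calc √(B / T) ≤ √(2 / √N) := Real.sqrt_le_sqrt h1
      _ = √2 / √√N := Real.sqrt_div (by norm_num) _
      _ ≤ 2 / √√N := by
          gcongr
          exact Real.sqrt_le_sqrt (by norm_num : (2 : ℝ) ≤ 4) |>.trans_eq
            (by rw [show (4 : ℝ) = 2 ^ 2 by norm_num]; exact Real.sqrt_sq (by norm_num))
  have hPhi : |Phi (x / √T) - Phi (x / √σ)| ≤ 2 / √√N := by
    rw [eT]
    refine (abs_Phi_div_sqrt_add_sub_le x hσ0 hB0.le).trans (hratio.trans ?_)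
    exact div_le_div_of_nonneg_left zero_le_two (by linarith)
      ((le_self_pow₀ hss two_ne_zero).trans_eq hss2)
  have hb : 0 < √B := Real.sqrt_pos.2 hB0
  have hunsmooth : |(∑ lam : N.Partition, if contentSum α lam ≤ x then jackP α lam else 0) -
      smoothedCdf α N B x| ≤
        6 * (smoothedCdf α N B (x + √B) - smoothedCdf α N B (x - √B)) := by
    rw [smoothedCdf, smoothedCdf, smoothedCdf, ← sum_sub_distrib, ← sum_sub_distrib, mul_sum]
    refine (abs_sum_le_sum_abs _ _).trans (sum_le_sum fun lam _ => ?_)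
    have h := mul_le_mul_of_nonneg_left
      (abs_indicator_sub_Phi_le ((x - contentSum α lam) / √B)) (jackP_nonneg h0 lam)
    rw [add_sub_right_comm, sub_right_comm, add_div, sub_div _ √B, div_self hb.ne']
    have hiff : 0 ≤ (x - contentSum α lam) / √B ↔ contentSum α lam ≤ x := by
      rw [le_div_iff₀ hb, zero_mul, sub_nonneg]
    simp only [hiff] at h
    calc _ = jackP α lam * |(if contentSum α lam ≤ x then 1 else 0) -
          Phi ((x - contentSum α lam) / √B)| := by
          nth_rewrite 3 [← abs_of_nonneg (jackP_nonneg h0 lam)]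
          rw [← abs_mul, mul_sub, mul_ite, mul_one, mul_zero]
      _ ≤ _ := h
      _ = _ := by ring
  have hη := abs_smoothedCdf_sub_Phi_le hα (show 1 ≤ N by omega)
  have h1 := hη x
  have h2 := (abs_le.1 (hη (x + √B))).2
  have h3 := (abs_le.1 (hη (x - √B))).1
  have h4 : Phi ((x + √B) / √T) - Phi ((x - √B) / √T) ≤ 2 * (2 / √√N) := by
    refine (le_abs_self _).trans ((abs_Phi_sub_le _ _).trans ?_)
    rw [← sub_div, show x + √B - (x - √B) = 2 * √B by ring, mul_div_assoc,
      abs_of_nonneg (by positivity)]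
    gcongr
  have h5 : (52 * (16 * α ^ 3 + 12) + 26) / √√(N : ℝ) =
      13 * (4 * (16 * α ^ 3 + 12) / √√N) + 13 * (2 / √√N) := by ring
  rw [h5]
  refine (abs_sub_le _ (smoothedCdf α N B x) _).trans ?_
  have h6 := abs_sub_le (smoothedCdf α N B x) (Phi (x / √T)) (Phi (x / √σ))
  linarith

end Lindeberg

/-- Central limit theorem for Jack measure (Theorem 2 of the paper). -/
theorem jack_measure_clt (α : ℝ) (hα : 1 ≤ α) :
    ∃ A : ℝ, 0 < A ∧ ∀ n : ℕ, 2 ≤ n → ∀ x₀ : ℝ,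
      |(∑ lam : n.Partition, if W α lam ≤ x₀ then jackP α lam else 0) - Phi x₀| ≤
        A * (n : ℝ) ^ (-(1 / 4 : ℝ)) := by
  refine ⟨52 * (16 * α ^ 3 + 12) + 26, by positivity, fun n hn x₀ => ?_⟩
  have hσ : 0 < √(α * n.choose 2) := Real.sqrt_pos.2
    (mul_pos (one_pos.trans_le hα) (by exact_mod_cast Nat.choose_pos hn))
  have h := abs_cdf_contentSum_sub_Phi_le hα hn (x₀ * √(α * n.choose 2))
  have hW : ∀ lam : n.Partition, W α lam ≤ x₀ ↔ contentSum α lam ≤ x₀ * √(α * n.choose 2) :=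
    fun lam => div_le_iff₀ hσ
  have hpow : (n : ℝ) ^ (-(1 / 4 : ℝ)) = 1 / √√n := by
    rw [Real.rpow_neg n.cast_nonneg, Real.sqrt_eq_rpow, Real.sqrt_eq_rpow,
      ← Real.rpow_mul n.cast_nonneg, one_div (_ ^ _)]
    norm_num
  simp only [hW]
  rwa [mul_div_cancel_right₀ _ hσ.ne', ← mul_one_div, ← hpow] at h

end JackTest
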